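/- Every Artin group whose defining labelled graph has exactly one cone point satisfies the Center Conjecture. -/

import Mathlib

/-- A labelled graph: a vertex set `V` and a symmetric labelling `m : V → V → ℕ∞`
with `m u v ≥ 2` for `u ≠ v` (`m u v = ∞` means no edge). -/
structure LabelledGraph (V : Type*) where
  m : V → V → ℕ∞
  symm : ∀ u v, m u v = m v u
  two_le : ∀ u v, u ≠ v → 2 ≤ m u v

namespace LabelledGraph

variable {V W : Type*}

/-- The alternating product `x * y * x * ⋯` with `n` terms. -/
def altProd {G : Type*} [Monoid G] (x y : G) : ℕ → G
  | 0 => 1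
  | n + 1 => x * altProd y x n

/-- The alternating word `u v u v ⋯` with `n` terms in the free group. -/
def altWord (u v : V) (n : ℕ) : FreeGroup V :=
  altProd (FreeGroup.of u) (FreeGroup.of v) n

/-- The Artin relations of a labelled graph: for each `u ≠ v` with finite label
`m u v = k`, the relation `(u v u ⋯) = (v u v ⋯)` (both sides with `k` terms). -/
def artinRels (Γ : LabelledGraph V) : Set (FreeGroup V) :=
  { r | ∃ (u v : V) (k : ℕ), u ≠ v ∧ Γ.m u v = (k : ℕ∞) ∧
        r = altWord u v k * (altWord v u k)⁻¹ }

/-- The Artin group of a labelled graph. -/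
abbrev ArtinGroup (Γ : LabelledGraph V) : Type _ := PresentedGroup Γ.artinRels

/-- The standard generators of an Artin group. -/
def σ (Γ : LabelledGraph V) (v : V) : Γ.ArtinGroup := PresentedGroup.of v

/-- The special subgroup of the Artin group generated by `{σ v : v ∈ K}`. -/
def specialSubgroup (Γ : LabelledGraph V) (K : Set V) : Subgroup Γ.ArtinGroup :=
  Subgroup.closure (Γ.σ '' K)

/-- A cone point of `Γ`: a vertex `t` with `m t v < ∞` for every `v ≠ t`. -/
def IsConePoint (Γ : LabelledGraph V) (t : V) : Prop :=
  ∀ v : V, v ≠ t → Γ.m t v ≠ ⊤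

/-- The induced labelled subgraph on a subset `K` of the vertices. -/
def induce (Γ : LabelledGraph V) (K : Set V) : LabelledGraph K where
  m u v := Γ.m u v
  symm u v := Γ.symm u v
  two_le u v h := Γ.two_le u v (fun e => h (Subtype.ext e))

/-- `Γ` is irreducible if its vertex set admits no partition into two nonempty sets
with all labels between the two parts equal to `2`. -/
def Irreducible (Γ : LabelledGraph V) : Prop :=
  ¬ ∃ V₁ V₂ : Set V, V₁.Nonempty ∧ V₂.Nonempty ∧ Disjoint V₁ V₂ ∧ V₁ ∪ V₂ = Set.univ ∧
      ∀ u ∈ V₁, ∀ v ∈ V₂, Γ.m u v = 2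

/-- The square relations `σ_v² = 1` defining the Coxeter quotient. -/
def squareRels (V : Type*) : Set (FreeGroup V) :=
  Set.range fun v : V => FreeGroup.of v * FreeGroup.of v

/-- The Coxeter group of a labelled graph: the quotient of the Artin group obtained
by adding the relations `σ_v² = 1`. -/
abbrev CoxeterGroupOf (Γ : LabelledGraph V) : Type _ :=
  PresentedGroup (Γ.artinRels ∪ squareRels V)

/-- `Γ` is spherical if its Coxeter group is finite. -/
def Spherical (Γ : LabelledGraph V) : Prop := Finite Γ.CoxeterGroupOf

/-- The natural surjection `θ` from the Artin group to the Coxeter group. -/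
def artinToCoxeter (Γ : LabelledGraph V) : Γ.ArtinGroup →* Γ.CoxeterGroupOf :=
  QuotientGroup.map _ _ (MonoidHom.id _)
    (by
      intro x hx
      simpa using Subgroup.normalClosure_mono (Set.subset_union_left (t := squareRels V)) hx)

/-- The pure Artin group: the kernel of the natural surjection to the Coxeter group. -/
def pureArtinGroup (Γ : LabelledGraph V) : Subgroup Γ.ArtinGroup :=
  (artinToCoxeter Γ).ker

/-- `P : Fin n → Set V` is a decomposition of `Γ` as a `2`-labelled join of
irreducible induced subgraphs. -/
def IsIrredDecomp (Γ : LabelledGraph V) (n : ℕ) (P : Fin n → Set V) : Prop :=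
  (∀ i, (P i).Nonempty) ∧
  (⋃ i, P i) = Set.univ ∧
  (∀ i j, i ≠ j → Disjoint (P i) (P j)) ∧
  (∀ i j, i ≠ j → ∀ u ∈ P i, ∀ v ∈ P j, Γ.m u v = 2) ∧
  (∀ i, (Γ.induce (P i)).Irreducible)

/-- `Γ` satisfies the Center Conjecture if for the (finest) decomposition of `Γ` as a
`2`-labelled join of irreducible induced subgraphs `Γ₁, …, Γₙ`, the center of the Artin
group `A_Γ` is free abelian of rank the number of spherical factors `Γᵢ`. -/
def SatisfiesCenterConjecture (Γ : LabelledGraph V) : Prop :=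
  ∀ (n : ℕ) (P : Fin n → Set V), Γ.IsIrredDecomp n P →
    Nonempty ((Subgroup.center Γ.ArtinGroup) ≃*
      Multiplicative (Fin (Nat.card {i : Fin n // (Γ.induce (P i)).Spherical}) → ℤ))

/-- A monoid hom applied to an alternating product. -/
theorem map_altProd {G H : Type*} [Monoid G] [Monoid H] (φ : G →* H) (x y : G) (n : ℕ) :
    φ (altProd x y n) = altProd (φ x) (φ y) n := by
  induction n generalizing x y with
  | zero => simp [altProd]
  | succ n ih => simp [altProd, ih]

/-- The homomorphism between Artin groups induced by a label-preserving injection of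
labelled graphs, sending generators to generators. -/
def mapHom (Γ : LabelledGraph V) (Δ : LabelledGraph W) (f : V → W)
    (hf : ∀ u v : V, u ≠ v → f u ≠ f v)
    (hm : ∀ u v : V, Γ.m u v = Δ.m (f u) (f v)) :
    Γ.ArtinGroup →* Δ.ArtinGroup :=
  PresentedGroup.toGroup (f := fun v => Δ.σ (f v))
    (by
      rintro r ⟨u, v, k, huv, hk, rfl⟩
      have key : ∀ (a b : V),
          FreeGroup.lift (fun v => Δ.σ (f v)) (altWord a b k)
            = PresentedGroup.mk Δ.artinRels (altWord (f a) (f b) k) := by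
        intro a b
        rw [altWord, map_altProd, altWord, map_altProd]
        simp [σ, PresentedGroup.of]
      rw [map_mul, map_inv, key, key, ← map_inv, ← map_mul]
      refine (QuotientGroup.eq_one_iff _).mpr (Subgroup.subset_normalClosure ?_)
      exact ⟨f u, f v, k, hf u v huv, (hm u v) ▸ hk, rfl⟩)

@[simp]
theorem mapHom_σ (Γ : LabelledGraph V) (Δ : LabelledGraph W) (f : V → W)
    (hf : ∀ u v : V, u ≠ v → f u ≠ f v)
    (hm : ∀ u v : V, Γ.m u v = Δ.m (f u) (f v)) (v : V) :
    mapHom Γ Δ f hf hm (Γ.σ v) = Δ.σ (f v) :=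
  PresentedGroup.toGroup.of _

/-- The homomorphism between the Artin groups of induced subgraphs coming from an
inclusion `K' ⊆ K`. -/
def induceHom (Γ : LabelledGraph V) {K' K : Set V} (h : K' ⊆ K) :
    (Γ.induce K').ArtinGroup →* (Γ.induce K).ArtinGroup :=
  mapHom _ _ (Set.inclusion h)
    (fun _ _ huv e => huv (Set.inclusion_injective h e))
    (fun _ _ => rfl)

/-- The homomorphism from the Artin group of an induced subgraph to the ambient
Artin group. -/
def inclHom (Γ : LabelledGraph V) (K : Set V) :
    (Γ.induce K).ArtinGroup →* Γ.ArtinGroup :=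
  mapHom _ _ Subtype.val
    (fun _ _ huv e => huv (Subtype.ext e))
    (fun _ _ => rfl)

end LabelledGraph

/-- The alternating product `⋯ * x * y * x` with `n` terms, ending in `x`. -/
def altProdRev {G : Type*} [Monoid G] (x y : G) : ℕ → G
  | 0 => 1
  | n + 1 => altProdRev y x n * x

section AltProdRev

variable {G H : Type*} [Monoid G] [Monoid H]

@[simp] theorem altProdRev_zero (x y : G) : altProdRev x y 0 = 1 := rfl

theorem altProdRev_succ (x y : G) (n : ℕ) : altProdRev x y (n + 1) = altProdRev y x n * x := rfl

theorem altProdRev_succ' (x y : G) (n : ℕ) :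
    altProdRev x y (n + 1) = (if Even n then x else y) * altProdRev x y n := by
  induction n generalizing x y with
  | zero => simp [altProdRev]
  | succ n ih =>
    rw [altProdRev_succ, ih, altProdRev_succ x y n, mul_assoc]
    by_cases h : Even n <;> simp [h, Nat.even_add_one]

theorem map_altProdRev (φ : G →* H) (x y : G) (n : ℕ) :
    φ (altProdRev x y n) = altProdRev (φ x) (φ y) n := by
  induction n generalizing x y with
  | zero => simp
  | succ n ih => simp [altProdRev_succ, ih]

namespace LabelledGraph

theorem altProd_eq_altProdRev (x y : G) (n : ℕ) :
    altProd x y n = if Even n then altProdRev y x n else altProdRev x y n := by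
  induction n generalizing x y with
  | zero => simp [altProd]
  | succ n ih =>
    rw [altProd, ih, altProdRev_succ', altProdRev_succ']
    by_cases h : Even n <;> simp [h, Nat.even_add_one]

theorem altProd_comm_iff (x y : G) (n : ℕ) :
    altProd x y n = altProd y x n ↔ altProdRev x y n = altProdRev y x n := by
  rw [altProd_eq_altProdRev, altProd_eq_altProdRev]
  by_cases h : Even n <;> simp [h, eq_comm]

end LabelledGraph

theorem CoxeterSystem.wordProd_alternatingWord {B W : Type*} [Group W] {M : CoxeterMatrix B}
    (cs : CoxeterSystem M W) (r s : B) (n : ℕ) :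
    cs.wordProd (CoxeterSystem.alternatingWord r s n)
      = altProdRev (cs.simple s) (cs.simple r) n := by
  induction n generalizing r s with
  | zero => simp [CoxeterSystem.alternatingWord]
  | succ n ih =>
    rw [CoxeterSystem.alternatingWord_succ, cs.wordProd_concat, ih, altProdRev_succ]

theorem CoxeterSystem.altProdRev_simple_comm {B W : Type*} [Group W] {M : CoxeterMatrix B}
    (cs : CoxeterSystem M W) (r s : B) :
    altProdRev (cs.simple r) (cs.simple s) (M r s)
      = altProdRev (cs.simple s) (cs.simple r) (M r s) := by
  have := cs.wordProd_braidWord_eq s r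
  simp only [CoxeterSystem.braidWord, cs.wordProd_alternatingWord] at this
  rwa [M.symmetric s r] at this

end AltProdRev

/-- The sequence `sin (n θ) / sin θ` written as a recurrence in `c = 2 cos θ`. -/
def sinRatio (c : ℝ) : ℕ → ℝ
  | 0 => 0
  | 1 => 1
  | n + 2 => c * sinRatio c (n + 1) - sinRatio c n

section SinRatio

open Real

theorem sinRatio_add_two (c : ℝ) (n : ℕ) :
    sinRatio c (n + 2) = c * sinRatio c (n + 1) - sinRatio c n := rfl

theorem sinRatio_mul_sin (θ : ℝ) (n : ℕ) : sinRatio (2 * cos θ) n * sin θ = sin (n * θ) := by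
  induction n using Nat.twoStepInduction with
  | zero => simp [sinRatio]
  | one => simp [sinRatio]
  | more n h0 h1 =>
    have e0 : ((n : ℕ) : ℝ) * θ = ((n + 1 : ℕ) : ℝ) * θ - θ := by push_cast; ring
    have e2 : ((n + 2 : ℕ) : ℝ) * θ = ((n + 1 : ℕ) : ℝ) * θ + θ := by push_cast; ring
    rw [sinRatio_add_two, sub_mul, h0, mul_assoc, h1, e0, e2, sin_sub, sin_add]
    ring

theorem sinRatio_two (n : ℕ) : sinRatio 2 n = n := by
  induction n using Nat.twoStepInduction with
  | zero => simp [sinRatio]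
  | one => simp [sinRatio]
  | more n h0 h1 => rw [sinRatio_add_two, h0, h1]; push_cast; ring

theorem sin_pi_div_pos {m : ℕ} (hm : 2 ≤ m) : 0 < sin (π / m) := by
  have : (2 : ℝ) ≤ m := by exact_mod_cast hm
  refine sin_pos_of_pos_of_lt_pi (by positivity) ?_
  rw [div_lt_iff₀ (by positivity)]
  nlinarith [pi_pos]

theorem sinRatio_pos {m n : ℕ} (hm : m ≠ 1) (hn : 0 < n) (hnm : m = 0 ∨ n < m) :
    0 < sinRatio (2 * cos (π / m)) n := by
  rcases Nat.eq_zero_or_pos m with rfl | hm0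
  · simp [sinRatio_two, hn]
  have h2 : 2 ≤ m := by omega
  have hnm' : n < m := by omega
  have hs := sin_pi_div_pos h2
  refine pos_of_mul_pos_left ?_ hs.le
  rw [sinRatio_mul_sin]
  have : (n : ℝ) < m := by exact_mod_cast hnm'
  have hn' : (0 : ℝ) < n := by exact_mod_cast hn
  refine sin_pos_of_pos_of_lt_pi (by positivity) ?_
  rw [← mul_div_assoc, div_lt_iff₀ (by positivity), mul_comm]
  gcongr

theorem sinRatio_self {m : ℕ} (hm : m ≠ 1) : sinRatio (2 * cos (π / m)) m = 0 := by
  rcases Nat.eq_zero_or_pos m with rfl | hm0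
  · simp [sinRatio]
  have hs := sin_pi_div_pos (m := m) (by omega)
  refine (mul_eq_zero.1 ?_).resolve_right hs.ne'
  rw [sinRatio_mul_sin, mul_div_cancel₀ _ (by positivity), sin_pi]

theorem sinRatio_pred {m : ℕ} (hm : 2 ≤ m) : sinRatio (2 * cos (π / m)) (m - 1) = 1 := by
  have hs := sin_pi_div_pos hm
  refine mul_right_cancel₀ hs.ne' ?_
  rw [sinRatio_mul_sin, Nat.cast_sub (by omega), sub_mul, mul_div_cancel₀ _ (by positivity)]
  simp [sin_pi_sub]

theorem sinRatio_nonneg {m n : ℕ} (hm : m ≠ 1) (hnm : m = 0 ∨ n ≤ m) :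
    0 ≤ sinRatio (2 * cos (π / m)) n := by
  rcases Nat.eq_zero_or_pos n with rfl | hn
  · simp [sinRatio]
  · by_cases h : n = m
    · rw [h, sinRatio_self hm]
    · exact (sinRatio_pos hm hn (by omega)).le

theorem cos_pi_div_injective {m n : ℕ}
    (h : cos (π / m) = cos (π / n)) : m = n := by
  have key (k : ℕ) : π / k ∈ Set.Icc 0 π := by
    refine ⟨by positivity, ?_⟩
    rcases Nat.eq_zero_or_pos k with rfl | hk
    · simp [pi_pos.le]
    · exact div_le_self pi_pos.le (by exact_mod_cast hk)
  have := injOn_cos (key m) (key n) h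
  rw [div_eq_mul_inv, div_eq_mul_inv] at this
  exact_mod_cast inv_injective (mul_left_cancel₀ pi_ne_zero this)

end SinRatio

namespace CoxeterMatrix

open Real Polynomial

variable {B : Type*} (M : CoxeterMatrix B)

/-- The matrix of the canonical bilinear form of a Coxeter matrix, scaled to have diagonal `2`. -/
noncomputable def cosMatrix (u v : B) : ℝ := -(2 * cos (π / M u v))

/-- The simple root attached to a vertex. -/
noncomputable def root (u : B) : B →₀ ℝ := Finsupp.single u 1

/-- The canonical bilinear form, with `canonicalForm (root u)` the coroot of `u`. -/
noncomputable def canonicalForm : (B →₀ ℝ) →ₗ[ℝ] (B →₀ ℝ) →ₗ[ℝ] ℝ :=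
  Finsupp.linearCombination ℝ fun u => Finsupp.linearCombination ℝ (M.cosMatrix u)

theorem cosMatrix_symm (u v : B) : M.cosMatrix u v = M.cosMatrix v u := by
  rw [cosMatrix, cosMatrix, M.symmetric]

theorem cosMatrix_self (u : B) : M.cosMatrix u u = 2 := by simp [cosMatrix]

theorem canonicalForm_root_root (u v : B) :
    M.canonicalForm (root u) (root v) = M.cosMatrix u v := by
  simp [canonicalForm, root]

theorem canonicalForm_root_self (u : B) : M.canonicalForm (root u) (root u) = 2 := by
  rw [canonicalForm_root_root, cosMatrix_self]

theorem canonicalForm_comm (e e' : B →₀ ℝ) : M.canonicalForm e e' = M.canonicalForm e' e := by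
  suffices M.canonicalForm = M.canonicalForm.flip from
    congrArg (fun f : (B →₀ ℝ) →ₗ[ℝ] (B →₀ ℝ) →ₗ[ℝ] ℝ => f e e') this
  ext u v
  simpa [root] using (M.canonicalForm_root_root u v).trans
    ((M.cosMatrix_symm u v).trans (M.canonicalForm_root_root v u).symm)

/-- The reflection attached to a vertex in the geometric representation. -/
noncomputable def rootReflection (u : B) : (B →₀ ℝ) ≃ₗ[ℝ] (B →₀ ℝ) :=
  Module.reflection (M.canonicalForm_root_self u)

theorem rootReflection_apply (u : B) (e : B →₀ ℝ) :
    M.rootReflection u e = e - M.canonicalForm (root u) e • root u :=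
  Module.reflection_apply _ _

theorem rootReflection_mul_self (u : B) : M.rootReflection u * M.rootReflection u = 1 :=
  LinearEquiv.ext fun e => Module.involutive_reflection (M.canonicalForm_root_self u) e

theorem eval_S_add_eval_S_eq_zero {m : ℕ} (hm : 3 ≤ m) :
    (Chebyshev.S ℝ (((m : ℤ) - 1) / 2)).eval (2 * cos (2 * (π / m))) *
      ((Chebyshev.S ℝ ((m : ℤ) / 2)).eval (2 * cos (2 * (π / m))) +
        (Chebyshev.S ℝ (((m : ℤ) - 2) / 2)).eval (2 * cos (2 * (π / m)))) = 0 ∧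
    (Chebyshev.S ℝ (((m : ℤ) - 2) / 2)).eval (2 * cos (2 * (π / m))) *
      ((Chebyshev.S ℝ (((m : ℤ) - 1) / 2)).eval (2 * cos (2 * (π / m))) +
        (Chebyshev.S ℝ (((m : ℤ) - 3) / 2)).eval (2 * cos (2 * (π / m)))) = 0 := by
  have hm' : (3 : ℝ) ≤ m := by exact_mod_cast hm
  have hs : sin (2 * (π / m)) ≠ 0 := by
    refine (sin_pos_of_pos_of_lt_pi (by positivity) ?_).ne'
    rw [← mul_div_assoc, div_lt_iff₀ (by positivity)]
    nlinarith [pi_pos]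
  have key (n : ℤ) := Chebyshev.S_two_mul_real_cos (2 * (π / m)) n
  have hm0 : (m : ℝ) ≠ 0 := by positivity
  rcases Nat.even_or_odd' m with ⟨p, hp | hp⟩
  · have e1 : ((m : ℤ) - 2) / 2 = p - 1 := by omega
    have e2 : ((m : ℤ) - 1) / 2 = p - 1 := by omega
    have hz : (Chebyshev.S ℝ ((p : ℤ) - 1)).eval (2 * cos (2 * (π / m))) = 0 := by
      refine (mul_eq_zero.1 ((key _).trans ?_)).resolve_right hs
      rw [← sin_pi]
      congr 1
      have : (m : ℝ) = 2 * p := by exact_mod_cast hp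
      push_cast
      have hp0 : (p : ℝ) ≠ 0 := by rintro h; simp [this, h] at hm0
      rw [this]
      field_simp
      ring
    rw [e1, e2, hz]
    simp
  · have e1 : ((m : ℤ) - 2) / 2 = p - 1 := by omega
    have e2 : ((m : ℤ) - 1) / 2 = p := by omega
    have e3 : (m : ℤ) / 2 = p := by omega
    have e4 : ((m : ℤ) - 3) / 2 = p - 1 := by omega
    have hz : (Chebyshev.S ℝ (p : ℤ)).eval (2 * cos (2 * (π / m))) +
        (Chebyshev.S ℝ ((p : ℤ) - 1)).eval (2 * cos (2 * (π / m))) = 0 := by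
      refine (mul_eq_zero.1 ?_).resolve_right hs
      rw [add_mul, key, key]
      have : (m : ℝ) = 2 * p + 1 := by exact_mod_cast hp
      have h : (((p : ℤ) : ℝ) + 1) * (2 * (π / m)) =
          2 * π - ((((p : ℤ) - 1 : ℤ) : ℝ) + 1) * (2 * (π / m)) + (2 * π / m - 2 * π / m) := by
        push_cast
        rw [this] at hm0 ⊢
        field_simp
        ring
      rw [h, sub_self, add_zero, sin_two_pi_sub]
      ring
    rw [e1, e2, e3, e4, hz]
    simp

theorem isLiftable_rootReflection : M.IsLiftable M.rootReflection := by
  intro u v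
  rcases eq_or_ne u v with rfl | huv
  · rw [rootReflection_mul_self, one_pow]
  have h1 : M u v ≠ 1 := M.off_diagonal u v huv
  by_cases h0 : M u v = 0
  · rw [h0, pow_zero]
  by_cases h2 : M u v = 2
  · have hc : M.cosMatrix u v = 0 := by simp [cosMatrix, h2]
    have hc' : M.cosMatrix v u = 0 := by rw [cosMatrix_symm, hc]
    have hcomm : M.rootReflection u * M.rootReflection v
        = M.rootReflection v * M.rootReflection u := by
      refine LinearEquiv.ext fun e => ?_
      simp only [LinearEquiv.mul_apply, rootReflection_apply, map_sub, map_smul,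
        canonicalForm_root_root, hc, hc']
      module
    rw [h2, sq, mul_assoc, ← mul_assoc (M.rootReflection v), ← hcomm, mul_assoc,
      rootReflection_mul_self, mul_one, rootReflection_mul_self]
  refine LinearEquiv.ext fun e => ?_
  have h3 : 3 ≤ M u v := by omega
  obtain ⟨z1, z2⟩ := eval_S_add_eval_S_eq_zero h3
  have ht : 2 * cos (2 * (π / M u v)) = M.canonicalForm (root u) (root v) *
      M.canonicalForm (root v) (root u) - 2 := by
    rw [canonicalForm_root_root, canonicalForm_root_root, M.cosMatrix_symm v u, cosMatrix,
      cos_two_mul]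
    ring
  rw [rootReflection, rootReflection, Module.reflection_mul_reflection_pow_apply _ _ _ _
    (2 * cos (2 * (π / M u v))) ht, z1, z2]
  simp

end CoxeterMatrix

namespace CoxeterSystem

open CoxeterMatrix Real

variable {B W : Type*} [Group W] {M : CoxeterMatrix B} (cs : CoxeterSystem M W)

/-- The geometric representation of a Coxeter group. -/
noncomputable def geomRep : W →* ((B →₀ ℝ) ≃ₗ[ℝ] (B →₀ ℝ)) :=
  cs.lift ⟨M.rootReflection, M.isLiftable_rootReflection⟩

theorem geomRep_simple (s : B) (e : B →₀ ℝ) :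
    cs.geomRep (cs.simple s) e = e - M.canonicalForm (root s) e • root s := by
  rw [geomRep, cs.lift_apply_simple, rootReflection_apply]

theorem geomRep_mul (w w' : W) (e : B →₀ ℝ) :
    cs.geomRep (w * w') e = cs.geomRep w (cs.geomRep w' e) := by
  rw [map_mul]; rfl

theorem geomRep_one (e : B →₀ ℝ) : cs.geomRep 1 e = e := by rw [map_one]; rfl

theorem geomRep_simple_root (s : B) : cs.geomRep (cs.simple s) (root s) = -root s := by
  rw [geomRep_simple, canonicalForm_root_self, two_smul]; abel

theorem canonicalForm_geomRep (w : W) (e e' : B →₀ ℝ) :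
    M.canonicalForm (cs.geomRep w e) (cs.geomRep w e') = M.canonicalForm e e' := by
  induction w using cs.simple_induction_left generalizing e e' with
  | one => simp
  | mul_simple_left w s ih =>
    rw [geomRep_mul, geomRep_mul, ← ih e e']
    simp only [geomRep_simple, map_sub, map_smul, LinearMap.sub_apply, LinearMap.smul_apply,
      canonicalForm_root_self, smul_eq_mul, M.canonicalForm_comm _ (root s)]
    ring

/-- The roots `s r s ⋯` of the rank two subsystem generated by `s` and `r`. -/
noncomputable def dihedralRoot (M : CoxeterMatrix B) (s r : B) (n : ℕ) : B →₀ ℝ :=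
  sinRatio (2 * cos (π / M s r)) (n + 1) • root s + sinRatio (2 * cos (π / M s r)) n • root r

theorem dihedralRoot_zero (s r : B) : dihedralRoot M s r 0 = root s := by
  simp [dihedralRoot, sinRatio]

theorem geomRep_simple_dihedralRoot (s r : B) (n : ℕ) :
    cs.geomRep (cs.simple s) (dihedralRoot M r s n) = dihedralRoot M s r (n + 1) := by
  rw [dihedralRoot, dihedralRoot, M.symmetric r s, map_add, map_smul, map_smul,
    geomRep_simple_root, geomRep_simple, canonicalForm_root_root, cosMatrix,
    sinRatio_add_two]
  module

theorem geomRep_altProdRev_root (r s : B) (n : ℕ) :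
    cs.geomRep (altProdRev (cs.simple r) (cs.simple s) n) (root s)
      = if Even n then dihedralRoot M s r n else dihedralRoot M r s n := by
  induction n with
  | zero => simp [dihedralRoot_zero]
  | succ n ih =>
    rw [altProdRev_succ', geomRep_mul, ih]
    by_cases h : Even n <;> simp [h, Nat.even_add_one, geomRep_simple_dihedralRoot]

theorem dihedralRoot_pred {s r : B} (h2 : 2 ≤ M s r) :
    dihedralRoot M s r (M s r - 1) = root r := by
  rw [dihedralRoot, Nat.sub_add_cancel (by omega), sinRatio_self (by omega), sinRatio_pred h2]
  simp

end CoxeterSystem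

namespace CoxeterSystem

open CoxeterMatrix Real

variable {B W : Type*} [Group W] {M : CoxeterMatrix B} (cs : CoxeterSystem M W)

theorem root_nonneg (s : B) : 0 ≤ root s := by
  intro u
  rw [root]
  exact Finsupp.single_nonneg.2 zero_le_one u

theorem geomRep_root_ne_zero (w : W) (s : B) : cs.geomRep w (root s) ≠ 0 := by
  rw [(cs.geomRep w).map_ne_zero_iff]
  simp [root]

theorem exists_eq_mul_altProdRev {w : W} {r s : B}
    (h : cs.length w < cs.length (w * cs.simple s)) :
    ∃ v k, w = v * altProdRev (cs.simple r) (cs.simple s) k ∧ cs.length w = cs.length v + k ∧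
      cs.length v < cs.length (v * cs.simple s) ∧ cs.length v < cs.length (v * cs.simple r) := by
  induction hn : cs.length w using Nat.strong_induction_on generalizing w r s with
  | _ n ih =>
    subst hn
    by_cases hr : cs.length w < cs.length (w * cs.simple r)
    · exact ⟨w, 0, by simp, by simp, h, hr⟩
    · have hl := (cs.length_mul_simple w r).resolve_left (by omega)
      obtain ⟨v, k, hw, hk, h1, h2⟩ := ih (cs.length (w * cs.simple r)) (by omega)
        (w := w * cs.simple r) (r := s) (s := r)
        (by rw [cs.simple_mul_simple_cancel_right]; omega) rfl
      refine ⟨v, k + 1, ?_, by omega, h2, h1⟩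
      rw [altProdRev_succ, ← mul_assoc, ← hw, cs.simple_mul_simple_cancel_right]

theorem geomRep_root_nonneg {w : W} {s : B} (h : cs.length w < cs.length (w * cs.simple s)) :
    0 ≤ cs.geomRep w (root s) := by
  induction hn : cs.length w using Nat.strong_induction_on generalizing w s with
  | _ n ih =>
    subst hn
    rcases eq_or_ne w 1 with rfl | hw
    · rw [geomRep_one]
      exact root_nonneg s
    obtain ⟨r, hr⟩ := cs.exists_rightDescent_of_ne_one hw
    rw [IsRightDescent] at hr
    have hrs : s ≠ r := by
      rintro rfl
      omega
    obtain ⟨v, k, hwv, hk, hs', hr'⟩ := cs.exists_eq_mul_altProdRev (r := r) h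
    have hk0 : k ≠ 0 := by
      rintro rfl
      rw [altProdRev_zero, mul_one] at hwv
      subst hwv
      omega
    have hvs := ih _ (by omega) hs' rfl
    have hvr := ih _ (by omega) hr' rfl
    have hred : cs.IsReduced (alternatingWord r s (k + 1)) := by
      have h1 := cs.length_mul_le v (altProdRev (cs.simple s) (cs.simple r) (k + 1))
      rw [altProdRev_succ, ← mul_assoc, ← hwv] at h1
      have h2 := cs.length_wordProd_le (alternatingWord r s (k + 1))
      rw [length_alternatingWord] at h2
      rw [IsReduced, length_alternatingWord]
      rw [wordProd_alternatingWord, altProdRev_succ] at h2 ⊢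
      have := cs.length_mul_simple w s
      omega
    have hM : M s r = 0 ∨ k + 1 ≤ M s r := by
      by_contra hc
      rw [M.symmetric] at hc
      exact cs.not_isReduced_alternatingWord r s (m := k + 1) (by omega) (by omega) hred
    have h1 := M.off_diagonal s r hrs
    have c1 := sinRatio_nonneg h1 (n := k) (by omega)
    have c2 := sinRatio_nonneg h1 (n := k + 1) (by omega)
    rw [hwv, geomRep_mul, geomRep_altProdRev_root]
    have key (x y : B) (hx : 0 ≤ cs.geomRep v (root x)) (hy : 0 ≤ cs.geomRep v (root y))
        (hxy : M x y = M s r) : 0 ≤ cs.geomRep v (dihedralRoot M x y k) := by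
      rw [dihedralRoot, hxy, map_add, map_smul, map_smul]
      exact add_nonneg (smul_nonneg c2 hx) (smul_nonneg c1 hy)
    split_ifs
    · exact key s r hvs hvr rfl
    · exact key r s hvr hvs (M.symmetric r s)

theorem geomRep_root_nonpos {w : W} {s : B} (h : cs.length (w * cs.simple s) < cs.length w) :
    cs.geomRep w (root s) ≤ 0 := by
  have := cs.geomRep_root_nonneg (w := w * cs.simple s) (s := s)
    (by rwa [cs.simple_mul_simple_cancel_right])
  rw [geomRep_mul, geomRep_simple_root, map_neg] at this
  exact neg_nonneg.1 this

theorem geomRep_root_nonneg_iff {w : W} {s : B} :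
    0 ≤ cs.geomRep w (root s) ↔ cs.length w < cs.length (w * cs.simple s) := by
  refine ⟨fun h => ?_, cs.geomRep_root_nonneg⟩
  by_contra hc
  have := cs.length_mul_simple_ne w s
  exact cs.geomRep_root_ne_zero w s
    (le_antisymm (cs.geomRep_root_nonpos (by omega)) h)

theorem geomRep_root_nonpos_of_not_nonneg {w : W} {s : B}
    (h : ¬ 0 ≤ cs.geomRep w (root s)) : cs.geomRep w (root s) ≤ 0 := by
  rw [geomRep_root_nonneg_iff] at h
  have := cs.length_mul_simple_ne w s
  exact cs.geomRep_root_nonpos (by omega)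

theorem geomRep_inv_root_nonneg_iff {w : W} {s : B} :
    0 ≤ cs.geomRep w⁻¹ (root s) ↔ cs.length w < cs.length (cs.simple s * w) := by
  rw [geomRep_root_nonneg_iff, ← cs.length_inv (cs.simple s * w), mul_inv_rev, cs.inv_simple,
    cs.length_inv]

/-- The only positive root made negative by a simple reflection is the simple root itself. -/
theorem geomRep_root_eq_root {w : W} {s x : B} (h : 0 ≤ cs.geomRep w (root x))
    (h' : ¬ 0 ≤ cs.geomRep (cs.simple s * w) (root x)) : cs.geomRep w (root x) = root s := by
  have hneg := cs.geomRep_root_nonpos_of_not_nonneg h'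
  rw [geomRep_mul, geomRep_simple] at hneg
  have hd : cs.geomRep w (root x) = cs.geomRep w (root x) s • root s := by
    ext u
    by_cases hu : s = u
    · subst hu
      simp [root]
    · have h1 := hneg u
      have h2 := h u
      simp only [Finsupp.sub_apply, Finsupp.smul_apply, root, Finsupp.single_eq_of_ne' hu,
        smul_zero, sub_zero, Finsupp.zero_apply] at h1 h2 ⊢
      exact le_antisymm h1 h2
  have hn := cs.canonicalForm_geomRep w (root x) (root x)
  have h0 := h s
  generalize cs.geomRep w (root x) s = d at hd h0
  rw [hd] at hn ⊢
  simp only [map_smul, LinearMap.smul_apply, canonicalForm_root_self, smul_eq_mul,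
    Finsupp.zero_apply] at hn h0
  have : d = 1 := by nlinarith
  rw [this, one_smul]

end CoxeterSystem

namespace CoxeterSystem

open CoxeterMatrix Real

variable {B W : Type*} [Group W] {M : CoxeterMatrix B} (cs : CoxeterSystem M W) (v : B)

/-- The minimal length representatives of the left cosets of the maximal parabolic subgroup
obtained by deleting `v`. -/
abbrev MinRep : Type _ := { w : W // ∀ x, x ≠ v → 0 ≤ cs.geomRep w (root x) }

/-- Left multiplication by `s` fixes the coset of the minimal representative `w`. -/
def FixesCoset (s : B) (w : cs.MinRep v) : Prop :=
  ∃ x, x ≠ v ∧ cs.geomRep w.1 (root x) = root s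

/-- The minimal representative of the trivial coset. -/
def MinRep.one : cs.MinRep v := ⟨1, fun x _ => by rw [geomRep_one]; exact root_nonneg x⟩

variable {v}

theorem root_injective : Function.Injective (root : B → B →₀ ℝ) :=
  Finsupp.single_left_injective one_ne_zero

theorem MinRep.nonneg (w : cs.MinRep v) {e : B →₀ ℝ} (he : 0 ≤ e) (hev : e v = 0) :
    0 ≤ cs.geomRep w.1 e := by
  rw [← e.sum_single, Finsupp.sum, map_sum]
  refine Finset.sum_nonneg fun a ha => ?_
  have hav : a ≠ v := by
    rintro rfl
    exact Finsupp.mem_support_iff.1 ha hev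
  rw [← mul_one (e a), ← smul_eq_mul, ← Finsupp.smul_single, map_smul]
  exact smul_nonneg (he a) (w.2 a hav)

open Classical in
/-- The action of a simple reflection on cosets, in terms of minimal representatives. -/
noncomputable def cosetStep (s : B) (w : cs.MinRep v) : cs.MinRep v :=
  if h : cs.FixesCoset v s w then w else
    ⟨cs.simple s * w.1, fun x hx => by
      by_contra hc
      exact h ⟨x, hx, cs.geomRep_root_eq_root (w.2 x hx) hc⟩⟩

theorem cosetStep_of_fixes {s : B} {w : cs.MinRep v} (h : cs.FixesCoset v s w) :
    cs.cosetStep s w = w := dif_pos h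

theorem cosetStep_of_not_fixes {s : B} {w : cs.MinRep v} (h : ¬ cs.FixesCoset v s w) :
    (cs.cosetStep s w).1 = cs.simple s * w.1 := by rw [cosetStep, dif_neg h]

theorem not_fixesCoset_cosetStep {s : B} {w : cs.MinRep v} (h : ¬ cs.FixesCoset v s w) :
    ¬ cs.FixesCoset v s (cs.cosetStep s w) := by
  rintro ⟨x, hx, hxs⟩
  rw [cosetStep_of_not_fixes cs h] at hxs
  have h1 : cs.geomRep w.1 (root x) = -root s := by
    rw [← cs.geomRep_simple_root, ← hxs, geomRep_mul, ← geomRep_mul, cs.simple_mul_simple_self,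
      geomRep_one]
  have h2 := w.2 x hx
  rw [h1] at h2
  have := h2 s
  simp [root] at this
  linarith

theorem cosetStep_involutive (s : B) :
    Function.Involutive (cs.cosetStep s : cs.MinRep v → cs.MinRep v) := by
  intro w
  by_cases h : cs.FixesCoset v s w
  · rw [cosetStep_of_fixes cs h, cosetStep_of_fixes cs h]
  · apply Subtype.ext
    rw [cosetStep_of_not_fixes cs (not_fixesCoset_cosetStep cs h), cosetStep_of_not_fixes cs h,
      cs.simple_mul_simple_cancel_left]

theorem cosetStep_ne {s : B} {w : cs.MinRep v} (h : ¬ cs.FixesCoset v s w) :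
    cs.cosetStep s w ≠ w := by
  intro hc
  have := congrArg (fun w : cs.MinRep v => cs.length w.1) hc
  simp only [cosetStep_of_not_fixes cs h] at this
  exact cs.length_simple_mul_ne _ _ this

variable (v) in
/-- The permutation of cosets induced by a simple reflection. -/
noncomputable def cosetPerm (s : B) : Equiv.Perm (cs.MinRep v) :=
  (cs.cosetStep_involutive s).toPerm

theorem cosetPerm_apply (s : B) (w : cs.MinRep v) : cs.cosetPerm v s w = cs.cosetStep s w := rfl

theorem geomRep_inv_cosetStep (s : B) (w : cs.MinRep v) (e : B →₀ ℝ) :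
    cs.geomRep (cs.cosetStep s w).1⁻¹ e v = cs.geomRep w.1⁻¹ (cs.geomRep (cs.simple s) e) v := by
  by_cases h : cs.FixesCoset v s w
  · rw [cosetStep_of_fixes cs h]
    obtain ⟨x, hx, hxs⟩ := h
    have hxs' : cs.geomRep w.1⁻¹ (root s) = root x := by
      rw [← hxs, ← geomRep_mul, inv_mul_cancel, geomRep_one]
    rw [geomRep_simple, map_sub, map_smul, hxs']
    simp [root, Finsupp.single_eq_of_ne' hx]
  · rw [cosetStep_of_not_fixes cs h, mul_inv_rev, cs.inv_simple, geomRep_mul]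

theorem geomRep_inv_altProdRev_cosetPerm (s r : B) (n : ℕ) (w : cs.MinRep v) (e : B →₀ ℝ) :
    cs.geomRep (altProdRev (cs.cosetPerm v s) (cs.cosetPerm v r) n w).1⁻¹ e v
      = cs.geomRep w.1⁻¹
          (cs.geomRep (altProdRev (cs.simple s) (cs.simple r) n)⁻¹ e) v := by
  induction n generalizing s r w with
  | zero => simp
  | succ n ih =>
    rw [altProdRev_succ, altProdRev_succ, Equiv.Perm.mul_apply, ih, cosetPerm_apply,
      geomRep_inv_cosetStep, ← geomRep_mul cs (cs.simple s), mul_inv_rev, cs.inv_simple]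

theorem MinRep.ext_of_geomRep_inv {w w' : cs.MinRep v}
    (h : ∀ e, cs.geomRep w.1⁻¹ e v = cs.geomRep w'.1⁻¹ e v) : w = w' := by
  by_contra hne
  have hu : w.1⁻¹ * w'.1 ≠ 1 := by
    intro hc
    exact hne (Subtype.ext (inv_mul_eq_one.1 hc))
  obtain ⟨s, hs⟩ := cs.exists_rightDescent_of_ne_one hu
  have hneg := cs.geomRep_root_nonpos hs
  have hco : cs.geomRep (w.1⁻¹ * w'.1) (root s) v = root s v := by
    rw [geomRep_mul, h, ← geomRep_mul, inv_mul_cancel, geomRep_one]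
  have hsv : s ≠ v := by
    rintro rfl
    have h1 := hneg s
    rw [hco] at h1
    simp [root] at h1
    linarith
  have h1 : 0 ≤ cs.geomRep w.1 (-cs.geomRep (w.1⁻¹ * w'.1) (root s)) := by
    refine w.nonneg cs (neg_nonneg.2 hneg) ?_
    rw [Finsupp.neg_apply, hco]
    simp [root, Finsupp.single_eq_of_ne' hsv]
  rw [map_neg, ← geomRep_mul, mul_inv_cancel_left] at h1
  exact cs.geomRep_root_ne_zero w'.1 s (le_antisymm (neg_nonneg.1 h1) (w'.2 s hsv))

theorem cosetPerm_braid (s r : B) :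
    altProdRev (cs.cosetPerm v s) (cs.cosetPerm v r) (M s r)
      = altProdRev (cs.cosetPerm v r) (cs.cosetPerm v s) (M s r) := by
  refine Equiv.ext fun w => MinRep.ext_of_geomRep_inv cs fun e => ?_
  rw [geomRep_inv_altProdRev_cosetPerm, geomRep_inv_altProdRev_cosetPerm,
    cs.altProdRev_simple_comm]

section Twisted

variable {G : Type*} [Group G] (g : B → G)

open Classical in
/-- The cocycle recording how a generator acts on the fibre over a coset. -/
noncomputable def cosetLabel (s : B) (w : cs.MinRep v) : G :=
  if h : cs.FixesCoset v s w then g h.choose else 1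

theorem cosetLabel_of_eq {s x : B} {w : cs.MinRep v} (hx : x ≠ v)
    (h : cs.geomRep w.1 (root x) = root s) : cs.cosetLabel g s w = g x := by
  have hf : cs.FixesCoset v s w := ⟨x, hx, h⟩
  rw [cosetLabel, dif_pos hf]
  congr 1
  exact root_injective ((cs.geomRep w.1).injective (hf.choose_spec.2.trans h.symm))

theorem cosetLabel_of_not_fixes {s : B} {w : cs.MinRep v} (h : ¬ cs.FixesCoset v s w) :
    cs.cosetLabel g s w = 1 := dif_neg h

theorem cosetLabel_cosetStep (s : B) (w : cs.MinRep v) :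
    cs.cosetLabel g s (cs.cosetStep s w) = cs.cosetLabel g s w := by
  by_cases h : cs.FixesCoset v s w
  · rw [cosetStep_of_fixes cs h]
  · rw [cosetLabel_of_not_fixes cs g h,
      cosetLabel_of_not_fixes cs g (not_fixesCoset_cosetStep cs h)]

/-- The action of a generator induced from the representation `g` of the maximal parabolic. -/
noncomputable def inducedPerm (s : B) : Equiv.Perm (G × cs.MinRep v) where
  toFun p := (cs.cosetLabel g s p.2 * p.1, cs.cosetStep s p.2)
  invFun p := ((cs.cosetLabel g s p.2)⁻¹ * p.1, cs.cosetStep s p.2)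
  left_inv p := by
    simp only [cosetLabel_cosetStep, inv_mul_cancel_left, cs.cosetStep_involutive s p.2]
  right_inv p := by
    simp only [cosetLabel_cosetStep, mul_inv_cancel_left, cs.cosetStep_involutive s p.2]

theorem inducedPerm_snd (s : B) (p : G × cs.MinRep v) :
    (cs.inducedPerm g s p).2 = cs.cosetPerm v s p.2 := rfl

theorem inducedPerm_of_eq {s x : B} {p : G × cs.MinRep v} (hx : x ≠ v)
    (h : cs.geomRep p.2.1 (root x) = root s) : cs.inducedPerm g s p = (g x * p.1, p.2) :=
  Prod.ext (congrArg (· * p.1) (cs.cosetLabel_of_eq g hx h))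
    (cs.cosetStep_of_fixes ⟨x, hx, h⟩)

theorem inducedPerm_of_not_fixes {s : B} {p : G × cs.MinRep v} (h : ¬ cs.FixesCoset v s p.2) :
    (cs.inducedPerm g s p).1 = p.1 ∧ (cs.inducedPerm g s p).2.1 = cs.simple s * p.2.1 :=
  ⟨(congrArg (· * p.1) (cs.cosetLabel_of_not_fixes g h)).trans (one_mul _),
    cs.cosetStep_of_not_fixes h⟩

theorem inducedPerm_inducedPerm {s : B} {p : G × cs.MinRep v} (h : ¬ cs.FixesCoset v s p.2) :
    cs.inducedPerm g s (cs.inducedPerm g s p) = p := by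
  refine Prod.ext ?_ (cs.cosetStep_involutive s p.2)
  rw [(cs.inducedPerm_of_not_fixes g (cs.not_fixesCoset_cosetStep h)).1,
    (cs.inducedPerm_of_not_fixes g h).1]

theorem altProdRev_inducedPerm_snd (s r : B) (n : ℕ) (p : G × cs.MinRep v) :
    (altProdRev (cs.inducedPerm g s) (cs.inducedPerm g r) n p).2
      = altProdRev (cs.cosetPerm v s) (cs.cosetPerm v r) n p.2 := by
  induction n generalizing s r p with
  | zero => simp
  | succ n ih => simp [altProdRev_succ, ih, inducedPerm_snd]

theorem altProdRev_inducedPerm_of_forall_ne (s r : B) (n : ℕ) (p : G × cs.MinRep v)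
    (h : ∀ j < n, ∀ x, x ≠ v → cs.geomRep p.2.1 (root x) ≠ dihedralRoot M s r j) :
    (altProdRev (cs.inducedPerm g s) (cs.inducedPerm g r) n p).1 = p.1 ∧
      (altProdRev (cs.inducedPerm g s) (cs.inducedPerm g r) n p).2.1
        = altProdRev (cs.simple s) (cs.simple r) n * p.2.1 := by
  induction n generalizing s r p with
  | zero => simp
  | succ n ih =>
    have hs : ¬ cs.FixesCoset v s p.2 := by
      rintro ⟨x, hx, hxs⟩
      exact h 0 n.succ_pos x hx (hxs.trans (dihedralRoot_zero s r).symm)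
    obtain ⟨e1, e2⟩ := cs.inducedPerm_of_not_fixes g hs
    obtain ⟨i1, i2⟩ := ih r s (cs.inducedPerm g s p) fun j hj x hx hxj => by
      refine h (j + 1) (by omega) x hx ?_
      rw [← cs.geomRep_simple_dihedralRoot, ← hxj, e2, ← geomRep_mul,
        cs.simple_mul_simple_cancel_left]
    rw [altProdRev_succ, altProdRev_succ, Equiv.Perm.mul_apply, i1, i2, e1, e2, mul_assoc]
    exact ⟨rfl, rfl⟩

theorem altProdRev_succ_inducedPerm_of_eq (s r x : B) (n : ℕ) (p : G × cs.MinRep v)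
    (h : ∀ j < n, ∀ x, x ≠ v → cs.geomRep p.2.1 (root x) ≠ dihedralRoot M s r j)
    (hx : x ≠ v) (hn : cs.geomRep p.2.1 (root x) = dihedralRoot M s r n) :
    (altProdRev (cs.inducedPerm g s) (cs.inducedPerm g r) (n + 1) p).1 = g x * p.1 ∧
      (altProdRev (cs.inducedPerm g s) (cs.inducedPerm g r) (n + 1) p).2.1
        = altProdRev (cs.simple s) (cs.simple r) n * p.2.1 := by
  induction n generalizing s r p with
  | zero =>
    rw [dihedralRoot_zero] at hn
    simp [altProdRev_succ, cs.inducedPerm_of_eq g hx hn]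
  | succ n ih =>
    have hs : ¬ cs.FixesCoset v s p.2 := by
      rintro ⟨x, hx, hxs⟩
      exact h 0 n.succ_pos x hx (hxs.trans (dihedralRoot_zero s r).symm)
    obtain ⟨e1, e2⟩ := cs.inducedPerm_of_not_fixes g hs
    have hback (j : ℕ) (x : B)
        (hxj : cs.geomRep (cs.inducedPerm g s p).2.1 (root x) = dihedralRoot M r s j) :
        cs.geomRep p.2.1 (root x) = dihedralRoot M s r (j + 1) := by
      rw [← cs.geomRep_simple_dihedralRoot, ← hxj, e2, ← geomRep_mul,
        cs.simple_mul_simple_cancel_left]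
    obtain ⟨i1, i2⟩ := ih r s (cs.inducedPerm g s p)
      (fun j hj x hx hxj => h (j + 1) (by omega) x hx (hback j x hxj))
      ((cs.geomRep (cs.simple s)).injective (by
        rw [cs.geomRep_simple_dihedralRoot, ← hn, e2, ← geomRep_mul,
          cs.simple_mul_simple_cancel_left]))
    rw [altProdRev_succ, Equiv.Perm.mul_apply, i1, i2, e1, e2,
      altProdRev_succ (cs.simple s), mul_assoc]
    exact ⟨rfl, rfl⟩

theorem altProdRev_inducedPerm_of_eq_of_eq {s r x y : B} (n : ℕ) (p : G × cs.MinRep v)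
    (hx : x ≠ v) (hy : y ≠ v) (hxs : cs.geomRep p.2.1 (root x) = root s)
    (hyr : cs.geomRep p.2.1 (root y) = root r) :
    altProdRev (cs.inducedPerm g s) (cs.inducedPerm g r) n p
      = (altProdRev (g x) (g y) n * p.1, p.2) := by
  induction n generalizing s r x y p with
  | zero => simp
  | succ n ih =>
    rw [altProdRev_succ, Equiv.Perm.mul_apply, cs.inducedPerm_of_eq g hx hxs,
      ih (g x * p.1, p.2) hy hx hyr hxs, altProdRev_succ (g x), mul_assoc]

theorem geomRep_root_ne_dihedralRoot {s r x : B} {w : W} (hsr : s ≠ r)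
    (hs : 0 ≤ cs.geomRep w⁻¹ (root s)) (hr : 0 ≤ cs.geomRep w⁻¹ (root r)) {j : ℕ} (hj : 0 < j)
    (hjm : j + 1 < M s r) : cs.geomRep w (root x) ≠ dihedralRoot M s r j := by
  intro h
  have h1 := M.off_diagonal s r hsr
  have c1 := sinRatio_pos (n := j) h1 hj (by omega)
  have c2 := sinRatio_pos (n := j + 1) h1 (by omega) (by omega)
  have hx : root x = cs.geomRep w⁻¹ (dihedralRoot M s r j) := by
    rw [← h, ← geomRep_mul, inv_mul_cancel, geomRep_one]
  rw [dihedralRoot, map_add, map_smul, map_smul] at hx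
  generalize sinRatio (2 * cos (π / M s r)) j = c at c1 hx
  generalize sinRatio (2 * cos (π / M s r)) (j + 1) = d at c2 hx
  have hz (u : B) (hu : u ≠ x) :
      cs.geomRep w⁻¹ (root s) u = 0 ∧ cs.geomRep w⁻¹ (root r) u = 0 := by
    have h2 := congrArg (fun e => e u) hx
    have h3 := hs u
    have h4 := hr u
    simp only [root, Finsupp.single_eq_of_ne hu, Finsupp.add_apply, Finsupp.smul_apply,
      smul_eq_mul, Finsupp.zero_apply] at h2 h3 h4 ⊢
    constructor <;> nlinarith
  have hs' : cs.geomRep w⁻¹ (root s) = cs.geomRep w⁻¹ (root s) x • root x := by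
    ext u
    by_cases hu : u = x
    · simp [hu, root]
    · rw [(hz u hu).1]
      simp [root, Finsupp.single_eq_of_ne hu]
  have hr' : cs.geomRep w⁻¹ (root r) = cs.geomRep w⁻¹ (root r) x • root x := by
    ext u
    by_cases hu : u = x
    · simp [hu, root]
    · rw [(hz u hu).2]
      simp [root, Finsupp.single_eq_of_ne hu]
  generalize cs.geomRep w⁻¹ (root s) x = a at hs'
  generalize cs.geomRep w⁻¹ (root r) x = b at hr'
  have hab : b • root s = a • root r := by
    refine (cs.geomRep w⁻¹).injective ?_
    rw [map_smul, map_smul, hs', hr', smul_smul, smul_smul, mul_comm]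
  have hb := congrArg (fun e => e s) hab
  simp only [root, Finsupp.smul_apply, Finsupp.single_eq_same, Finsupp.single_eq_of_ne hsr,
    smul_eq_mul, mul_one, mul_zero] at hb
  rw [hb, zero_smul] at hr'
  exact cs.geomRep_root_ne_zero _ _ hr'

/-- The family `g` satisfies the braid relations among the vertices other than `v`. -/
def SatisfiesBraidAway (M : CoxeterMatrix B) (v : B) (g : B → G) : Prop :=
  ∀ x y, x ≠ v → y ≠ v → x ≠ y → M x y ≠ 0 →
    altProdRev (g x) (g y) (M x y) = altProdRev (g y) (g x) (M x y)

variable {g}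

theorem inducedPerm_braid_of_not_fixes {s r : B} (hsr : s ≠ r) (hm : M s r ≠ 0)
    (p : G × cs.MinRep v)
    (hs : 0 ≤ cs.geomRep p.2.1⁻¹ (root s)) (hr : 0 ≤ cs.geomRep p.2.1⁻¹ (root r))
    (hpr : ¬ cs.FixesCoset v r p.2) :
    altProdRev (cs.inducedPerm g s) (cs.inducedPerm g r) (M s r) p
      = altProdRev (cs.inducedPerm g r) (cs.inducedPerm g s) (M s r) p := by
  have h1 := M.off_diagonal s r hsr
  obtain ⟨n, hn⟩ : ∃ n, M s r = n + 1 := Nat.exists_eq_succ_of_ne_zero hm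
  have hlast : dihedralRoot M r s n = root s := by
    have := dihedralRoot_pred (M := M) (s := r) (r := s) (by rw [M.symmetric]; omega)
    rwa [M.symmetric r s, hn, Nat.add_sub_cancel] at this
  have hrs : ∀ j < n, ∀ x, x ≠ v → cs.geomRep p.2.1 (root x) ≠ dihedralRoot M r s j := by
    intro j hj x hx
    rcases Nat.eq_zero_or_pos j with rfl | hj0
    · rw [dihedralRoot_zero]
      exact fun h => hpr ⟨x, hx, h⟩
    · exact cs.geomRep_root_ne_dihedralRoot hsr.symm hr hs hj0 (by rw [M.symmetric]; omega)
  by_cases hps : cs.FixesCoset v s p.2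
  · obtain ⟨x, hx, hxs⟩ := hps
    obtain ⟨a1, a2⟩ := cs.altProdRev_succ_inducedPerm_of_eq g r s x n p hrs hx
      (hxs.trans hlast.symm)
    obtain ⟨b1, b2⟩ := cs.altProdRev_inducedPerm_of_forall_ne g r s n (g x * p.1, p.2) hrs
    rw [hn]
    refine Prod.ext ?_ (Subtype.ext ?_)
    · rw [a1, altProdRev_succ, Equiv.Perm.mul_apply, cs.inducedPerm_of_eq g hx hxs, b1]
    · rw [a2, altProdRev_succ, Equiv.Perm.mul_apply, cs.inducedPerm_of_eq g hx hxs, b2]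
  · obtain ⟨a1, a2⟩ := cs.altProdRev_inducedPerm_of_forall_ne g r s (n + 1) p fun j hj x hx => by
      rcases Nat.lt_succ_iff_lt_or_eq.1 hj with hj | rfl
      · exact hrs j hj x hx
      · rw [hlast]
        exact fun h => hps ⟨x, hx, h⟩
    obtain ⟨b1, b2⟩ := cs.altProdRev_inducedPerm_of_forall_ne g s r (n + 1) p fun j hj x hx => by
      rcases Nat.eq_zero_or_pos j with rfl | hj0
      · rw [dihedralRoot_zero]
        exact fun h => hps ⟨x, hx, h⟩
      rcases Nat.lt_succ_iff_lt_or_eq.1 hj with hj | rfl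
      · exact cs.geomRep_root_ne_dihedralRoot hsr hs hr hj0 (by omega)
      · have := dihedralRoot_pred (M := M) (s := s) (r := r) (by omega)
        rw [hn, Nat.add_sub_cancel] at this
        rw [this]
        exact fun h => hpr ⟨x, hx, h⟩
    rw [← hn] at a1 a2 b1 b2
    refine Prod.ext (b1.trans a1.symm) (Subtype.ext ?_)
    rw [a2, b2, cs.altProdRev_simple_comm]

theorem inducedPerm_braid_of_nonneg (hg : SatisfiesBraidAway M v g) {s r : B} (hsr : s ≠ r)
    (hm : M s r ≠ 0) (p : G × cs.MinRep v)
    (hs : 0 ≤ cs.geomRep p.2.1⁻¹ (root s)) (hr : 0 ≤ cs.geomRep p.2.1⁻¹ (root r)) :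
    altProdRev (cs.inducedPerm g s) (cs.inducedPerm g r) (M s r) p
      = altProdRev (cs.inducedPerm g r) (cs.inducedPerm g s) (M s r) p := by
  by_cases hpr : cs.FixesCoset v r p.2
  · by_cases hps : cs.FixesCoset v s p.2
    · obtain ⟨x, hx, hxs⟩ := hps
      obtain ⟨y, hy, hyr⟩ := hpr
      rw [cs.altProdRev_inducedPerm_of_eq_of_eq g _ p hx hy hxs hyr,
        cs.altProdRev_inducedPerm_of_eq_of_eq g _ p hy hx hyr hxs]
      have hxy : M x y = M s r := by
        have := cs.canonicalForm_geomRep p.2.1 (root x) (root y)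
        rw [hxs, hyr, canonicalForm_root_root, canonicalForm_root_root, cosMatrix, cosMatrix,
          neg_inj] at this
        exact (cos_pi_div_injective (mul_left_cancel₀ two_ne_zero this)).symm
      have hne : x ≠ y := by
        rintro rfl
        exact hsr (root_injective (hxs.symm.trans hyr))
      rw [← hxy, hg x y hx hy hne (by rwa [hxy])]
    · rw [M.symmetric s r] at hm ⊢
      exact (cs.inducedPerm_braid_of_not_fixes hsr.symm hm p hr hs hps).symm
  · exact cs.inducedPerm_braid_of_not_fixes hsr hm p hs hr hpr

theorem inducedPerm_braid_of_inducedPerm {s r : B} (hm : M s r ≠ 0) (p : G × cs.MinRep v)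
    (hp : ¬ cs.FixesCoset v s p.2)
    (h : altProdRev (cs.inducedPerm g s) (cs.inducedPerm g r) (M s r) (cs.inducedPerm g s p)
      = altProdRev (cs.inducedPerm g r) (cs.inducedPerm g s) (M s r) (cs.inducedPerm g s p)) :
    altProdRev (cs.inducedPerm g s) (cs.inducedPerm g r) (M s r) p
      = altProdRev (cs.inducedPerm g r) (cs.inducedPerm g s) (M s r) p := by
  obtain ⟨n, hn⟩ : ∃ n, M s r = n + 1 := Nat.exists_eq_succ_of_ne_zero hm
  set q := altProdRev (cs.inducedPerm g r) (cs.inducedPerm g s) n (cs.inducedPerm g s p) with hq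
  set z := if Even n then r else s with hz
  have hlast : altProdRev (cs.inducedPerm g r) (cs.inducedPerm g s) (M s r)
      (cs.inducedPerm g s p) = cs.inducedPerm g z q := by
    rw [hn, altProdRev_succ', hq, Equiv.Perm.mul_apply, hz, apply_ite (cs.inducedPerm g)]
  have hleft : altProdRev (cs.inducedPerm g s) (cs.inducedPerm g r) (M s r) p = q := by
    rw [hn, altProdRev_succ, Equiv.Perm.mul_apply]
  have hright : altProdRev (cs.inducedPerm g r) (cs.inducedPerm g s) (M s r) p
      = cs.inducedPerm g z (cs.inducedPerm g z q) := by
    have h1 := altProdRev_succ' (cs.inducedPerm (v := v) g s) (cs.inducedPerm g r) (M s r)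
    rw [altProdRev_succ] at h1
    have h2 := DFunLike.congr_fun h1 (cs.inducedPerm g s p)
    rw [Equiv.Perm.mul_apply, Equiv.Perm.mul_apply, cs.inducedPerm_inducedPerm g hp, h, hlast] at h2
    rw [h2, hn, hz]
    by_cases hev : Even n <;> simp [hev, Nat.even_add_one]
  have hfree : ¬ cs.FixesCoset v z q.2 := by
    intro hc
    have h1 : (cs.inducedPerm g z q).2 = q.2 := cs.cosetStep_of_fixes hc
    rw [← hlast, ← hleft, altProdRev_inducedPerm_snd, altProdRev_inducedPerm_snd,
      cs.cosetPerm_braid] at h1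
    exact cs.cosetStep_ne hp (Equiv.injective _ h1)
  rw [hleft, hright, cs.inducedPerm_inducedPerm g hfree]

/-- The induced permutations satisfy all braid relations. -/
theorem inducedPerm_braid (hg : SatisfiesBraidAway M v g) {s r : B} (hsr : s ≠ r)
    (hm : M s r ≠ 0) :
    altProdRev (cs.inducedPerm (v := v) g s) (cs.inducedPerm g r) (M s r)
      = altProdRev (cs.inducedPerm g r) (cs.inducedPerm g s) (M s r) := by
  refine Equiv.ext fun p => ?_
  induction hl : cs.length p.2.1 using Nat.strong_induction_on generalizing p with
  | _ n ih =>
    subst hl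
    have key (s : B) (h : ¬ 0 ≤ cs.geomRep p.2.1⁻¹ (root s)) :
        ¬ cs.FixesCoset v s p.2 ∧ cs.length (cs.inducedPerm g s p).2.1 < cs.length p.2.1 := by
      have hf : ¬ cs.FixesCoset v s p.2 := by
        rintro ⟨x, -, hxs⟩
        rw [← hxs, ← geomRep_mul, inv_mul_cancel, geomRep_one] at h
        exact h (root_nonneg x)
      refine ⟨hf, ?_⟩
      rw [geomRep_inv_root_nonneg_iff] at h
      rw [(cs.inducedPerm_of_not_fixes g hf).2]
      have := cs.length_simple_mul_ne p.2.1 s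
      omega
    by_cases hs : 0 ≤ cs.geomRep p.2.1⁻¹ (root s)
    · by_cases hr : 0 ≤ cs.geomRep p.2.1⁻¹ (root r)
      · exact cs.inducedPerm_braid_of_nonneg hg hsr hm p hs hr
      · obtain ⟨hf, hlt⟩ := key r hr
        have := ih _ hlt (cs.inducedPerm g r p) rfl
        rw [M.symmetric] at this hm ⊢
        exact (cs.inducedPerm_braid_of_inducedPerm hm p hf this.symm).symm
    · obtain ⟨hf, hlt⟩ := key s hs
      exact cs.inducedPerm_braid_of_inducedPerm hm p hf (ih _ hlt _ rfl)

end Twisted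

end CoxeterSystem

namespace LabelledGraph

open CoxeterMatrix CoxeterSystem

variable {V : Type*} (Γ : LabelledGraph V)

theorem altProdRev_σ_comm {u v : V} {k : ℕ} (huv : u ≠ v) (hk : Γ.m u v = k) :
    altProdRev (Γ.σ u) (Γ.σ v) k = altProdRev (Γ.σ v) (Γ.σ u) k := by
  rw [← altProd_comm_iff]
  have h : PresentedGroup.mk Γ.artinRels (altWord u v k * (altWord v u k)⁻¹) = 1 :=
    (QuotientGroup.eq_one_iff _).2 (Subgroup.subset_normalClosure ⟨u, v, k, huv, hk, rfl⟩)
  rw [map_mul, map_inv, mul_inv_eq_one, altWord, altWord, map_altProd, map_altProd] at h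
  exact h

/-- The homomorphism out of an Artin group given by a family satisfying the braid relations. -/
def artinLift {G : Type*} [Group G] (f : V → G)
    (hf : ∀ (u v : V) (k : ℕ), u ≠ v → Γ.m u v = k →
      altProdRev (f u) (f v) k = altProdRev (f v) (f u) k) : Γ.ArtinGroup →* G :=
  PresentedGroup.toGroup (f := f) (by
    rintro r ⟨u, v, k, huv, hk, rfl⟩
    rw [map_mul, map_inv, mul_inv_eq_one, altWord, altWord, map_altProd, map_altProd,
      FreeGroup.lift_apply_of, FreeGroup.lift_apply_of, altProd_comm_iff]
    exact hf u v k huv hk)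

@[simp] theorem artinLift_σ {G : Type*} [Group G] (f : V → G)
    (hf : ∀ (u v : V) (k : ℕ), u ≠ v → Γ.m u v = k →
      altProdRev (f u) (f v) k = altProdRev (f v) (f u) k) (v : V) :
    Γ.artinLift f hf (Γ.σ v) = f v :=
  PresentedGroup.toGroup.of _

theorem closure_range_σ : Subgroup.closure (Set.range Γ.σ) = ⊤ :=
  PresentedGroup.closure_range_of _

/-- The exponent sum homomorphism. -/
def degree : Γ.ArtinGroup →* Multiplicative ℤ :=
  Γ.artinLift (fun _ => Multiplicative.ofAdd 1) fun _ _ _ _ _ => rfl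

theorem σ_zpow_eq_one_iff (v : V) (n : ℤ) : Γ.σ v ^ n = 1 ↔ n = 0 := by
  refine ⟨fun h => ?_, fun h => by rw [h, zpow_zero]⟩
  have := congrArg (fun z => (Γ.degree z).toAdd) h
  simpa [degree] using this

open Classical in
/-- The Coxeter matrix of a labelled graph, with `0` encoding the label `∞`. -/
noncomputable def coxeterMatrix : CoxeterMatrix V where
  M := Matrix.of fun u v => if u = v then 1 else (Γ.m u v).toNat
  isSymm := by
    ext u v
    simp [eq_comm, Γ.symm u v]
  diagonal u := by simp
  off_diagonal u v huv := by
    simp only [Matrix.of_apply, if_neg huv]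
    intro h
    have h2 := Γ.two_le u v huv
    rw [ENat.toNat_eq_iff one_ne_zero] at h
    rw [h] at h2
    exact absurd h2 (by decide)

theorem coxeterMatrix_apply {u v : V} (huv : u ≠ v) :
    Γ.coxeterMatrix u v = (Γ.m u v).toNat := if_neg huv

theorem m_eq_coxeterMatrix {u v : V} (huv : u ≠ v) (h : Γ.coxeterMatrix u v ≠ 0) :
    Γ.m u v = Γ.coxeterMatrix u v := by
  rw [Γ.coxeterMatrix_apply huv] at h ⊢
  exact ((ENat.toNat_eq_iff h).1 rfl)

theorem coxeterMatrix_eq {u v : V} {k : ℕ} (huv : u ≠ v) (h : Γ.m u v = k) :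
    Γ.coxeterMatrix u v = k := by
  rw [Γ.coxeterMatrix_apply huv, h, ENat.toNat_natCast]

theorem satisfiesBraidAway_σ (v : V) : SatisfiesBraidAway Γ.coxeterMatrix v Γ.σ :=
  fun _ _ _ _ hxy h => Γ.altProdRev_σ_comm hxy (Γ.m_eq_coxeterMatrix hxy h)

/-- Minimal representatives of the cosets of the standard parabolic subgroup omitting `v`. -/
abbrev MinRep (v : V) : Type _ := CoxeterSystem.MinRep Γ.coxeterMatrix.toCoxeterSystem v

/-- The permutation of `A × MinRep v` by which the generator `s` acts. -/
noncomputable def genPerm (v s : V) : Equiv.Perm (Γ.ArtinGroup × Γ.MinRep v) :=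
  Γ.coxeterMatrix.toCoxeterSystem.inducedPerm Γ.σ s

/-- The action of the Artin group on pairs of an element and a coset of the standard parabolic
subgroup omitting `v` in the Coxeter group. -/
noncomputable def cosetAction (v : V) :
    Γ.ArtinGroup →* Equiv.Perm (Γ.ArtinGroup × Γ.MinRep v) :=
  Γ.artinLift (Γ.genPerm v) fun s r k hsr hk => by
    have hM := Γ.coxeterMatrix_eq hsr hk
    have hk0 : k ≠ 0 := by
      rintro rfl
      have := Γ.two_le s r hsr
      rw [hk] at this
      exact absurd this (by decide)
    rw [← hM]
    exact inducedPerm_braid _ (Γ.satisfiesBraidAway_σ v) hsr (by rwa [hM])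

/-- The base point of the action lying over `a`. -/
noncomputable def basePt (v : V) (a : Γ.ArtinGroup) : Γ.ArtinGroup × Γ.MinRep v :=
  (a, MinRep.one _ v)

theorem cosetAction_σ (v s : V) : Γ.cosetAction v (Γ.σ s) = Γ.genPerm v s :=
  Γ.artinLift_σ _ _ s

theorem cosetAction_basePt {v : V} {y : Γ.ArtinGroup} (hy : y ∈ Γ.specialSubgroup {x | x ≠ v})
    (a : Γ.ArtinGroup) : Γ.cosetAction v y (Γ.basePt v a) = Γ.basePt v (y * a) := by
  induction hy using Subgroup.closure_induction generalizing a with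
  | mem y hy =>
    obtain ⟨x, hx, rfl⟩ := hy
    rw [cosetAction_σ]
    exact inducedPerm_of_eq _ Γ.σ hx (geomRep_one _ _)
  | one => simp
  | mul y z _ _ hy hz => rw [map_mul, Equiv.Perm.mul_apply, hz, hy, mul_assoc]
  | inv y _ hy => rw [map_inv, Equiv.Perm.inv_eq_iff_eq, hy, mul_inv_cancel_left]

/-- The points of `A × MinRep v` whose two components are supported on `Y`. -/
def SupportedOn {v : V} (Y : Set V) (p : Γ.ArtinGroup × Γ.MinRep v) : Prop :=
  p.1 ∈ Γ.specialSubgroup (Y \ {v}) ∧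
    ∀ e : V →₀ ℝ, (∀ u, u ∉ Y → e u = 0) → ∀ u, u ∉ Y →
      Γ.coxeterMatrix.toCoxeterSystem.geomRep p.2.1⁻¹ e u = 0

variable {Γ}

theorem root_apply_of_notMem {Y : Set V} {s u : V} (hs : s ∈ Y) (hu : u ∉ Y) : root s u = 0 := by
  rw [root, Finsupp.single_eq_of_ne]
  rintro rfl
  exact hu hs

theorem SupportedOn.cosetStep {v : V} {Y : Set V} {p : Γ.ArtinGroup × Γ.MinRep v}
    (hp : Γ.SupportedOn Y p) {s : V} (hs : s ∈ Y) :
    Γ.coxeterMatrix.toCoxeterSystem.cosetLabel Γ.σ s p.2 ∈ Γ.specialSubgroup (Y \ {v}) ∧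
    ∀ e : V →₀ ℝ, (∀ u, u ∉ Y → e u = 0) → ∀ u, u ∉ Y →
      Γ.coxeterMatrix.toCoxeterSystem.geomRep
        (Γ.coxeterMatrix.toCoxeterSystem.cosetStep s p.2).1⁻¹ e u = 0 := by
  set cs := Γ.coxeterMatrix.toCoxeterSystem
  by_cases h : cs.FixesCoset v s p.2
  · rw [cosetStep_of_fixes cs h]
    refine ⟨?_, hp.2⟩
    obtain ⟨x, hx, hxs⟩ := h
    rw [cosetLabel_of_eq cs Γ.σ hx hxs]
    refine Subgroup.subset_closure ⟨x, ⟨?_, hx⟩, rfl⟩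
    by_contra hxY
    have h1 := hp.2 (root s) (fun u hu => root_apply_of_notMem hs hu) x hxY
    rw [← hxs, ← geomRep_mul, inv_mul_cancel, geomRep_one] at h1
    simp [root] at h1
  · rw [cosetLabel_of_not_fixes cs _ h, cosetStep_of_not_fixes cs h]
    refine ⟨one_mem _, fun e he u hu => ?_⟩
    rw [mul_inv_rev, cs.inv_simple, geomRep_mul]
    refine hp.2 _ (fun x hx => ?_) u hu
    rw [geomRep_simple, Finsupp.sub_apply, Finsupp.smul_apply, he x hx,
      root_apply_of_notMem hs hx, smul_zero, sub_zero]

theorem supportedOn_cosetAction_iff {v : V} {Y : Set V} {y : Γ.ArtinGroup}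
    (hy : y ∈ Γ.specialSubgroup Y) (p : Γ.ArtinGroup × Γ.MinRep v) :
    Γ.SupportedOn Y (Γ.cosetAction v y p) ↔ Γ.SupportedOn Y p := by
  induction hy using Subgroup.closure_induction generalizing p with
  | mem y hy =>
    obtain ⟨s, hs, rfl⟩ := hy
    rw [cosetAction_σ]
    constructor
    · intro h
      have := h.cosetStep hs
      rw [← (Γ.genPerm v s).symm_apply_apply p]
      exact ⟨mul_mem (inv_mem this.1) h.1, this.2⟩
    · intro h
      have := h.cosetStep hs
      exact ⟨mul_mem this.1 h.1, this.2⟩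
  | one => simp
  | mul y z _ _ hy hz => rw [map_mul, Equiv.Perm.mul_apply, hy, hz]
  | inv y _ hy => rw [← hy, ← Equiv.Perm.mul_apply, ← map_mul, mul_inv_cancel, map_one,
    Equiv.Perm.one_apply]

/-- Special subgroups intersect as expected when one of them omits a single vertex. -/
theorem mem_specialSubgroup_diff {v : V} {Y : Set V} {z : Γ.ArtinGroup}
    (hY : z ∈ Γ.specialSubgroup Y) (hv : z ∈ Γ.specialSubgroup {x | x ≠ v}) :
    z ∈ Γ.specialSubgroup (Y \ {v}) := by
  have h1 : Γ.SupportedOn Y (Γ.basePt v 1) :=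
    ⟨one_mem _, fun e he u hu => by
      rw [basePt, MinRep.one, inv_one, geomRep_one]
      exact he u hu⟩
  have h2 := (supportedOn_cosetAction_iff hY (Γ.basePt v 1)).2 h1
  rw [cosetAction_basePt Γ hv, mul_one] at h2
  exact h2.1

theorem not_fixesCoset_one (v : V) :
    ¬ Γ.coxeterMatrix.toCoxeterSystem.FixesCoset v v (MinRep.one _ v) := by
  rintro ⟨x, hx, h⟩
  rw [MinRep.one, geomRep_one] at h
  exact hx (root_injective h)

theorem genPerm_mul_self {v s : V} {p : Γ.ArtinGroup × Γ.MinRep v}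
    (h : ¬ Γ.coxeterMatrix.toCoxeterSystem.FixesCoset v s p.2) (n : ℤ) :
    Γ.cosetAction v (Γ.σ s ^ (2 * n)) p = p := by
  rw [zpow_mul, map_zpow]
  refine Function.IsFixedPt.perm_zpow ?_ n
  rw [zpow_ofNat, sq, map_mul, cosetAction_σ]
  exact inducedPerm_inducedPerm _ Γ.σ h

theorem eq_zero_of_σ_zpow_mem {v : V} {n : ℤ} (h : Γ.σ v ^ n ∈ Γ.specialSubgroup {x | x ≠ v}) :
    n = 0 := by
  have h1 := cosetAction_basePt Γ (zpow_mem h 2) 1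
  rw [← zpow_mul, mul_comm n, genPerm_mul_self (not_fixesCoset_one v)] at h1
  have h2 : (1 : Γ.ArtinGroup) = Γ.σ v ^ (2 * n) * 1 := congrArg Prod.fst h1
  rw [mul_one, eq_comm, σ_zpow_eq_one_iff] at h2
  omega

theorem eq_zero_of_commute_σ_zpow {t v : V} {n : ℤ} (htv : t ≠ v) (hm : Γ.m t v ≠ 2)
    (h : Commute (Γ.σ t ^ n) (Γ.σ v)) : n = 0 := by
  set cs := Γ.coxeterMatrix.toCoxeterSystem with hcs
  have hv := not_fixesCoset_one (Γ := Γ) v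
  obtain ⟨e1, e2⟩ := inducedPerm_of_not_fixes cs Γ.σ (p := Γ.basePt v 1) hv
  have hfree : ¬ cs.FixesCoset v t (Γ.cosetAction v (Γ.σ v) (Γ.basePt v 1)).2 := by
    rintro ⟨x, hx, hxt⟩
    rw [cosetAction_σ, genPerm, e2] at hxt
    rw [basePt, MinRep.one, mul_one, geomRep_simple, canonicalForm_root_root] at hxt
    have hxt' : x = t := by
      by_contra hne
      have := congrArg (fun e => e x) hxt
      simp [root, Finsupp.single_eq_of_ne hx, Finsupp.single_eq_of_ne hne] at this
    subst hxt'
    have h0 := congrArg (fun e => e v) hxt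
    simp only [root, Finsupp.sub_apply, Finsupp.smul_apply, Finsupp.single_eq_same,
      Finsupp.single_eq_of_ne' hx, cosMatrix, smul_eq_mul] at h0
    have h2 : Γ.coxeterMatrix v x = 2 := by
      refine cos_pi_div_injective ?_
      rw [Nat.cast_ofNat, Real.cos_pi_div_two]
      linarith
    rw [Γ.coxeterMatrix_apply hx.symm, ENat.toNat_eq_iff two_ne_zero, Γ.symm] at h2
    exact hm h2
  have hc : Commute (Γ.σ t ^ (2 * n)) (Γ.σ v) := by
    rw [mul_comm, zpow_mul]
    exact h.zpow_left 2
  have h1 := congrArg (fun z => (Γ.cosetAction v z (Γ.basePt v 1)).1) hc.eq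
  have ht : Γ.σ t ^ (2 * n) ∈ Γ.specialSubgroup {x | x ≠ v} :=
    zpow_mem (Subgroup.subset_closure ⟨t, htv, rfl⟩ : Γ.σ t ∈ Γ.specialSubgroup {x | x ≠ v}) _
  simp only [map_mul, Equiv.Perm.mul_apply] at h1
  rw [genPerm_mul_self hfree, cosetAction_basePt Γ ht, cosetAction_σ, genPerm, e1,
    (inducedPerm_of_not_fixes cs Γ.σ (p := Γ.basePt v (Γ.σ t ^ (2 * n) * 1)) hv).1] at h1
  have h2 : (1 : Γ.ArtinGroup) = Γ.σ t ^ (2 * n) * 1 := h1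
  rw [mul_one, eq_comm, σ_zpow_eq_one_iff] at h2
  omega

end LabelledGraph

namespace Monoid.PushoutI

variable {ι H : Type*} {G : ι → Type*} [∀ i, Group (G i)] [Group H] {φ : ∀ i, H →* G i}

/-- Products of letters taken alternately from different factors, none of them in the amalgamated
subgroup; the indices are those of the first and the last letter. -/
inductive IsAlternating (φ : ∀ i, H →* G i) : ι → ι → PushoutI φ → Prop
  | single {i : ι} (g : G i) (hg : g ∉ (φ i).range) : IsAlternating φ i i (of i g)
  | cons {i j k : ι} (g : G i) (hg : g ∉ (φ i).range) (hij : i ≠ j) {x : PushoutI φ}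
      (hx : IsAlternating φ j k x) : IsAlternating φ i k (of i g * x)

namespace IsAlternating

variable {i j k l : ι} {x y : PushoutI φ}

theorem append (hx : IsAlternating φ i j x) (hjk : j ≠ k) (hy : IsAlternating φ k l y) :
    IsAlternating φ i l (x * y) := by
  induction hx with
  | single g hg => exact cons g hg hjk hy
  | cons g hg hij _ ih =>
    rw [mul_assoc]
    exact cons g hg hij (ih hjk)

theorem inv (hx : IsAlternating φ i j x) : IsAlternating φ j i x⁻¹ := by
  induction hx with
  | single g hg =>
    rw [← map_inv]
    exact single _ (by rwa [inv_mem_iff])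
  | cons g hg hij _ ih =>
    rw [mul_inv_rev, ← map_inv]
    exact ih.append hij.symm (single _ (by rwa [inv_mem_iff]))

theorem base_mul (h : H) (hx : IsAlternating φ i j x) : IsAlternating φ i j (base φ h * x) := by
  cases hx with
  | single g hg =>
    rw [← of_apply_eq_base φ i, ← map_mul]
    exact single _ (by rwa [Subgroup.mul_mem_cancel_left _ (MonoidHom.mem_range.2 ⟨h, rfl⟩)])
  | cons g hg hij hx =>
    rw [← of_apply_eq_base φ i, ← mul_assoc, ← map_mul]
    exact cons _ (by rwa [Subgroup.mul_mem_cancel_left _ (MonoidHom.mem_range.2 ⟨h, rfl⟩)]) hij hx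

theorem exists_of_mul (hx : IsAlternating φ i j x) : ∃ g₁ ∉ (φ i).range, ∀ g,
    (g * g₁ ∉ (φ i).range → IsAlternating φ i j (of i g * x)) ∧
    (g * g₁ ∈ (φ i).range → of i g * x ∈ (base φ).range ∨
      ∃ k l, IsAlternating φ k l (of i g * x)) := by
  cases hx with
  | single g₁ hg₁ =>
    refine ⟨g₁, hg₁, fun g => ⟨fun h => ?_, ?_⟩⟩
    · rw [← map_mul]
      exact single _ h
    · rintro ⟨c, hc⟩
      left
      rw [← map_mul, ← hc, of_apply_eq_base]
      exact ⟨c, rfl⟩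
  | cons g₁ hg₁ hij hx =>
    refine ⟨g₁, hg₁, fun g => ⟨fun h => ?_, ?_⟩⟩
    · rw [← mul_assoc, ← map_mul]
      exact cons _ h hij hx
    · rintro ⟨c, hc⟩
      right
      rw [← mul_assoc, ← map_mul, ← hc, of_apply_eq_base]
      exact ⟨_, _, hx.base_mul c⟩

theorem exists_word (hx : IsAlternating φ i j x) : ∃ w : CoprodI.Word G,
    w.fstIdx = some i ∧ Reduced φ w ∧ ofCoprodI w.prod = x := by
  have hne {i : ι} {g : G i} (hg : g ∉ (φ i).range) : g ≠ 1 := by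
    rintro rfl
    exact hg (one_mem _)
  induction hx with
  | single g hg =>
    have h0 (k : ι) : (CoprodI.Word.empty : CoprodI.Word G).fstIdx ≠ some k := nofun
    refine ⟨CoprodI.Word.cons g .empty (h0 _) (hne hg), CoprodI.Word.fstIdx_cons .., ?_, by
      rw [CoprodI.Word.prod_cons, CoprodI.Word.prod_empty, mul_one, ofCoprodI_of]⟩
    intro p hp
    simp only [CoprodI.Word.cons, CoprodI.Word.empty, List.mem_singleton] at hp
    subst hp
    exact hg
  | cons g hg hij _ ih =>
    obtain ⟨w, hw, hr, rfl⟩ := ih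
    refine ⟨CoprodI.Word.cons g w (by simpa [hw] using hij.symm) (hne hg),
      CoprodI.Word.fstIdx_cons .., ?_, by rw [CoprodI.Word.prod_cons, map_mul, ofCoprodI_of]⟩
    intro p hp
    simp only [CoprodI.Word.cons, List.mem_cons] at hp
    rcases hp with rfl | hp
    · exact hg
    · exact hr p hp

theorem notMem_range_base (hφ : ∀ i, Function.Injective (φ i)) (hx : IsAlternating φ i j x) :
    x ∉ (base φ).range := by
  obtain ⟨w, hw, hr, rfl⟩ := hx.exists_word
  intro h
  rw [hr.eq_empty_of_mem_range hφ h] at hw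
  simp [CoprodI.Word.fstIdx, CoprodI.Word.empty] at hw

end IsAlternating

theorem mem_range_base_or_isAlternating (x : PushoutI φ) :
    x ∈ (base φ).range ∨ ∃ i j, IsAlternating φ i j x := by
  suffices ∀ y : PushoutI φ, (y ∈ (base φ).range ∨ ∃ i j, IsAlternating φ i j y) →
      x * y ∈ (base φ).range ∨ ∃ i j, IsAlternating φ i j (x * y) by
    simpa using this 1 (Or.inl (one_mem _))
  induction x using induction_on with
  | of i g =>
    rintro y (⟨c, rfl⟩ | ⟨j, k, hy⟩)
    · by_cases h : g * φ i c ∈ (φ i).range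
      · obtain ⟨d, hd⟩ := h
        exact Or.inl ⟨d, by rw [← of_apply_eq_base φ i, hd, map_mul, of_apply_eq_base]⟩
      · rw [← of_apply_eq_base φ i, ← map_mul]
        exact Or.inr ⟨i, i, .single _ h⟩
    · by_cases hg : g ∈ (φ i).range
      · obtain ⟨c, rfl⟩ := hg
        rw [of_apply_eq_base]
        exact Or.inr ⟨j, k, hy.base_mul c⟩
      · rcases eq_or_ne i j with rfl | hij
        · obtain ⟨g₁, -, h⟩ := hy.exists_of_mul
          by_cases hgg : g * g₁ ∈ (φ i).range
          · exact (h g).2 hgg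
          · exact Or.inr ⟨i, k, (h g).1 hgg⟩
        · exact Or.inr ⟨i, k, .cons g hg hij hy⟩
  | base c =>
    rintro y (hy | ⟨j, k, hy⟩)
    · exact Or.inl (mul_mem ⟨c, rfl⟩ hy)
    · exact Or.inr ⟨j, k, hy.base_mul c⟩
  | mul a b ha hb =>
    intro y hy
    rw [mul_assoc]
    exact ha _ (hb y hy)

/-- In an amalgamated product, an element commuting with suitable elements of each of the factors
lies in the amalgamated subgroup. -/
theorem mem_range_base_of_commute [Nontrivial ι] (hφ : ∀ i, Function.Injective (φ i))
    (g : ∀ i, G i) (hg : ∀ i, g i ∉ (φ i).range) (hg2 : ∀ i, g i * g i ∉ (φ i).range)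
    {z : PushoutI φ} (hz : ∀ i, Commute z (of i (g i))) : z ∈ (base φ).range := by
  rcases mem_range_base_or_isAlternating z with hzb | ⟨i, j, hzij⟩
  · exact hzb
  exfalso
  rcases eq_or_ne i j with rfl | hij
  · obtain ⟨j, hji⟩ := exists_ne i
    have h := (hzij.append hji.symm (.single _ (hg j))).append hji
      (hzij.inv.append hji.symm (IsAlternating.single _ (hg j)).inv)
    refine h.notMem_range_base hφ ?_
    rw [(hz j).eq, ← mul_assoc, mul_inv_cancel_right, mul_inv_cancel]
    exact one_mem _
  · obtain ⟨g₁, hg₁, h⟩ := hzij.exists_of_mul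
    obtain ⟨a, ha, hag, haz⟩ : ∃ a : G i, a ∉ (φ i).range ∧ a * g₁ ∉ (φ i).range ∧
        Commute z (of i a) := by
      by_cases hc : g i * g₁ ∈ (φ i).range
      · refine ⟨g i * g i, hg2 i, fun hc2 => hg i ?_, ?_⟩
        · have := mul_mem hc2 (inv_mem hc)
          rwa [mul_inv_rev, mul_assoc (g i * g i), mul_inv_cancel_left,
            mul_inv_cancel_right] at this
        · rw [map_mul]
          exact (hz i).mul_right (hz i)
      · exact ⟨g i, hg i, hc, hz i⟩
    have h2 := (hzij.append hij.symm (.single a ha)).append hij ((h a).1 hag).inv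
    refine h2.notMem_range_base hφ ?_
    rw [haz.eq, mul_inv_cancel]
    exact one_mem _

end Monoid.PushoutI

namespace LabelledGraph

open Monoid

variable {V : Type*} (Γ : LabelledGraph V)

theorem σ_mem_specialSubgroup {v : V} {Y : Set V} (hv : v ∈ Y) : Γ.σ v ∈ Γ.specialSubgroup Y :=
  Subgroup.subset_closure ⟨v, hv, rfl⟩

theorem specialSubgroup_mono {Y Z : Set V} (h : Y ⊆ Z) :
    Γ.specialSubgroup Y ≤ Γ.specialSubgroup Z :=
  Subgroup.closure_mono (Set.image_mono h)

/-- The inclusions of special subgroups with respect to which an Artin group is amalgamated when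
the vertices `p false` and `p true` are not joined by an edge. -/
def amalgamHom (p : Bool → V) (b : Bool) :
    Γ.specialSubgroup {x | ∀ c, x ≠ p c} →* Γ.specialSubgroup {x | x ≠ p b} :=
  Subgroup.inclusion (Γ.specialSubgroup_mono fun _ hx => hx b)

variable {Γ}

theorem amalgamHom_injective (p : Bool → V) (b : Bool) : Function.Injective (Γ.amalgamHom p b) :=
  Subgroup.inclusion_injective _

theorem subtype_comp_amalgamHom (p : Bool → V) (b : Bool) :
    (Γ.specialSubgroup {x | x ≠ p b}).subtype.comp (Γ.amalgamHom p b) =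
      (Γ.specialSubgroup {x | ∀ c, x ≠ p c}).subtype :=
  Subgroup.subtype_comp_inclusion _

theorem exists_forall_ne (p : Bool → V) (hp : p false ≠ p true) (x : V) : ∃ b, x ≠ p b := by
  by_cases h : x = p false
  · exact ⟨true, h ▸ hp⟩
  · exact ⟨false, h⟩

/-- The generators of the amalgamated product. -/
noncomputable def amalgamGen (p : Bool → V) (hp : p false ≠ p true) (x : V) :
    PushoutI (Γ.amalgamHom p) :=
  PushoutI.of (Exists.choose (exists_forall_ne p hp x))
    ⟨Γ.σ x, Γ.σ_mem_specialSubgroup (Exists.choose_spec (exists_forall_ne p hp x))⟩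

theorem amalgamGen_eq (p : Bool → V) (hp : p false ≠ p true) {x : V} {b : Bool} (hx : x ≠ p b) :
    amalgamGen p hp x =
      PushoutI.of (φ := Γ.amalgamHom p) b ⟨Γ.σ x, Γ.σ_mem_specialSubgroup hx⟩ := by
  have hc := Exists.choose_spec (exists_forall_ne p hp x)
  rw [amalgamGen]
  generalize_proofs _ h1
  generalize Exists.choose _ = c at *
  by_cases hcb : c = b
  · subst hcb
    rfl
  · have hx' : ∀ d, x ≠ p d := by
      intro d
      cases b <;> cases c <;> cases d <;> simp_all
    have h (d : Bool) : (⟨Γ.σ x, Γ.σ_mem_specialSubgroup (hx' d)⟩ : Γ.specialSubgroup {x | x ≠ p d})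
        = Γ.amalgamHom p d ⟨Γ.σ x, Γ.σ_mem_specialSubgroup hx'⟩ := rfl
    rw [h b, h c, PushoutI.of_apply_eq_base, PushoutI.of_apply_eq_base]

/-- The homomorphism from an Artin group to its decomposition as an amalgamated product along two
vertices not joined by an edge. -/
noncomputable def toAmalgam (p : Bool → V) (hp : p false ≠ p true)
    (hm : Γ.m (p false) (p true) = ⊤) : Γ.ArtinGroup →* PushoutI (Γ.amalgamHom p) :=
  Γ.artinLift (amalgamGen p hp) fun x y k hxy hk => by
    obtain ⟨b, hx, hy⟩ : ∃ b, x ≠ p b ∧ y ≠ p b := by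
      by_contra! h
      have hne : Γ.m x y ≠ ⊤ := by
        rw [hk]
        exact ENat.natCast_ne_top k
      have hm' := (Γ.symm _ _).trans hm
      by_cases h0 : x = p false
      · by_cases h1 : x = p true
        · exact hp (h0.symm.trans h1)
        · rw [h0, h true h1] at hne
          exact hne hm
      · by_cases h1 : x = p true
        · rw [h1, h false h0] at hne
          exact hne hm'
        · exact hp ((h _ h0).symm.trans (h _ h1))
    rw [amalgamGen_eq p hp hx, amalgamGen_eq p hp hy, ← map_altProdRev, ← map_altProdRev]
    congr 1
    apply Subtype.val_injective
    rw [← Subgroup.subtype_apply, ← Subgroup.subtype_apply, map_altProdRev, map_altProdRev]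
    exact Γ.altProdRev_σ_comm hxy hk

/-- The homomorphism from the amalgamated product to the Artin group. -/
def ofAmalgam (p : Bool → V) : PushoutI (Γ.amalgamHom p) →* Γ.ArtinGroup :=
  PushoutI.lift (fun b => (Γ.specialSubgroup {x | x ≠ p b}).subtype)
    (Γ.specialSubgroup {x | ∀ c, x ≠ p c}).subtype (subtype_comp_amalgamHom p)

theorem ofAmalgam_toAmalgam (p : Bool → V) (hp : p false ≠ p true)
    (hm : Γ.m (p false) (p true) = ⊤) (z : Γ.ArtinGroup) :
    ofAmalgam p (toAmalgam p hp hm z) = z := by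
  suffices (ofAmalgam p).comp (toAmalgam p hp hm) = MonoidHom.id _ from DFunLike.congr_fun this z
  refine PresentedGroup.ext fun x => ?_
  change ofAmalgam p (toAmalgam p hp hm (Γ.σ x)) = Γ.σ x
  rw [toAmalgam, artinLift_σ, amalgamGen, ofAmalgam, PushoutI.lift_of]
  rfl

theorem mem_specialSubgroup_of_mem_center (p : Bool → V) (hp : p false ≠ p true)
    (hm : Γ.m (p false) (p true) = ⊤) {z : Γ.ArtinGroup} (hz : z ∈ Subgroup.center Γ.ArtinGroup) :
    z ∈ Γ.specialSubgroup {x | ∀ c, x ≠ p c} := by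
  have hpb (b : Bool) : p (!b) ≠ p b := by
    cases b
    · exact hp.symm
    · exact hp
  have hrange (b : Bool) {y : Γ.specialSubgroup {x | x ≠ p b}} {n : ℤ} (hn : n ≠ 0)
      (hy : (y : Γ.ArtinGroup) = Γ.σ (p (!b)) ^ n) : y ∉ (Γ.amalgamHom p b).range := by
    rintro ⟨c, rfl⟩
    refine hn (eq_zero_of_σ_zpow_mem (Γ := Γ) (v := p (!b)) ?_)
    rw [← hy]
    exact Γ.specialSubgroup_mono (fun x (hx : ∀ c, x ≠ p c) => hx _) c.2
  have h : toAmalgam p hp hm z ∈ (PushoutI.base (Γ.amalgamHom p)).range :=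
    PushoutI.mem_range_base_of_commute (amalgamHom_injective p)
      (fun b => ⟨Γ.σ (p (!b)), Γ.σ_mem_specialSubgroup (hpb b)⟩)
      (fun b => hrange b one_ne_zero (zpow_one _).symm)
      (fun b => hrange b two_ne_zero (by rw [zpow_ofNat, sq]; rfl))
      (fun b => by
        rw [← amalgamGen_eq p hp (hpb b), ← artinLift_σ Γ (amalgamGen p hp)]
        exact Commute.map (Subgroup.mem_center_iff.1 hz _).symm (toAmalgam p hp hm))
  obtain ⟨c, hc⟩ := h
  rw [← ofAmalgam_toAmalgam p hp hm z, ← hc, ofAmalgam, PushoutI.lift_base]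
  exact c.2

theorem mem_specialSubgroup_ne_of_mem_center {u v : V} (huv : u ≠ v) (hm : Γ.m u v = ⊤)
    {z : Γ.ArtinGroup} (hz : z ∈ Subgroup.center Γ.ArtinGroup) :
    z ∈ Γ.specialSubgroup {x | x ≠ u} :=
  Γ.specialSubgroup_mono (fun x (hx : ∀ b, x ≠ bif b then v else u) => hx false)
    (mem_specialSubgroup_of_mem_center (fun b => bif b then v else u) huv hm hz)

theorem mem_specialSubgroup_compl [Finite V] {Y : Set V} {z : Γ.ArtinGroup}
    (h : ∀ v ∈ Y, z ∈ Γ.specialSubgroup {x | x ≠ v}) : z ∈ Γ.specialSubgroup Yᶜ := by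
  induction Y, Y.toFinite using Set.Finite.induction_on with
  | empty =>
    rw [Set.compl_empty, specialSubgroup, Set.image_univ, closure_range_σ]
    exact Subgroup.mem_top z
  | @insert a s _ _ ih =>
    rw [← Set.union_singleton, Set.compl_union]
    exact mem_specialSubgroup_diff (ih fun v hv => h v (Set.mem_insert_of_mem _ hv))
      (h a (Set.mem_insert _ _))

/-- If every vertex other than `t` is incident to a label `∞`, the center of the Artin group
consists of powers of the generator at `t`. -/
theorem exists_zpow_of_mem_center [Finite V] {t : V}
    (ht : ∀ v, v ≠ t → ∃ w, v ≠ w ∧ Γ.m v w = ⊤)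
    {z : Γ.ArtinGroup} (hz : z ∈ Subgroup.center Γ.ArtinGroup) : ∃ n : ℤ, Γ.σ t ^ n = z := by
  have h : z ∈ Γ.specialSubgroup {t} := by
    rw [← compl_compl ({t} : Set V)]
    refine mem_specialSubgroup_compl fun v hv => ?_
    obtain ⟨w, hvw, hm⟩ := ht v hv
    exact mem_specialSubgroup_ne_of_mem_center hvw hm hz
  rw [specialSubgroup, Set.image_singleton] at h
  exact Subgroup.mem_closure_singleton.1 h

end LabelledGraph

namespace LabelledGraph

open CoxeterMatrix CoxeterSystem

variable {V : Type*} (Γ : LabelledGraph V)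

/-- The homomorphism from the Coxeter group of a labelled graph to the Coxeter group of the
associated Coxeter matrix. -/
noncomputable def coxeterGroupHom : Γ.CoxeterGroupOf →* Γ.coxeterMatrix.Group :=
  PresentedGroup.toGroup (f := Γ.coxeterMatrix.toCoxeterSystem.simple) (by
    rintro r (⟨u, v, k, huv, hk, rfl⟩ | ⟨v, rfl⟩)
    · rw [map_mul, map_inv, mul_inv_eq_one, altWord, altWord, map_altProd, map_altProd,
        FreeGroup.lift_apply_of, FreeGroup.lift_apply_of, altProd_comm_iff,
        ← Γ.coxeterMatrix_eq huv hk]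
      exact altProdRev_simple_comm _ _ _
    · rw [map_mul, FreeGroup.lift_apply_of, simple_mul_simple_self])

theorem coxeterGroupHom_of (v : V) : Γ.coxeterGroupHom (PresentedGroup.of v) =
    Γ.coxeterMatrix.toCoxeterSystem.simple v :=
  PresentedGroup.toGroup.of _

variable {Γ}

theorem not_spherical_of_m_eq_top {u v : V} (huv : u ≠ v) (hm : Γ.m u v = ⊤) :
    ¬ Γ.Spherical := by
  intro (h : Finite _)
  have hM : Γ.coxeterMatrix v u = 0 := by
    rw [Γ.coxeterMatrix_apply huv.symm, Γ.symm, hm, ENat.toNat_top]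
  have hinj : Function.Injective fun n : ℕ =>
      altProdRev (PresentedGroup.of u : Γ.CoxeterGroupOf) (PresentedGroup.of v) (2 * n) := by
    intro a b hab
    have key (n : ℕ) : Γ.coxeterMatrix.toCoxeterSystem.geomRep (Γ.coxeterGroupHom
        (altProdRev (PresentedGroup.of u) (PresentedGroup.of v) (2 * n))) (root v) v
          = 2 * n + 1 := by
      rw [map_altProdRev, coxeterGroupHom_of, coxeterGroupHom_of, geomRep_altProdRev_root,
        if_pos (even_two_mul n), dihedralRoot, hM, Nat.cast_zero, div_zero, Real.cos_zero,
        mul_one, sinRatio_two, sinRatio_two]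
      simp [root, Finsupp.single_eq_of_ne' huv]
    have h2 := (key a).symm.trans ((congrArg (fun w =>
      Γ.coxeterMatrix.toCoxeterSystem.geomRep (Γ.coxeterGroupHom w) (root v) v) hab).trans (key b))
    have h3 : (a : ℝ) = b := by linarith
    exact_mod_cast h3
  exact not_injective_infinite_finite _ hinj

theorem spherical_of_unique [Unique V] : Γ.Spherical := by
  set s : Γ.CoxeterGroupOf := PresentedGroup.of default
  have hs : s * s = 1 := (QuotientGroup.eq_one_iff _).2
    (Subgroup.subset_normalClosure (Or.inr ⟨default, rfl⟩))
  have hfin : Finite (Subgroup.zpowers s) := finite_zpowers.2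
    (isOfFinOrder_iff_pow_eq_one.2 ⟨2, two_pos, by rw [sq, hs]⟩)
  have htop : Subgroup.zpowers s = ⊤ := by
    rw [Subgroup.zpowers_eq_closure, ← PresentedGroup.closure_range_of, Set.range_unique]
  rw [htop] at hfin
  exact Subgroup.topEquiv.toEquiv.finite_iff.1 hfin

theorem σ_mem_center {t : V} (h : ∀ v, v ≠ t → Γ.m t v = 2) :
    Γ.σ t ∈ Subgroup.center Γ.ArtinGroup := by
  rw [← Subgroup.centralizer_univ, ← Subgroup.coe_top, ← closure_range_σ,
    Subgroup.centralizer_closure, Subgroup.mem_centralizer_iff]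
  rintro _ ⟨v, rfl⟩
  rcases eq_or_ne v t with rfl | hv
  · rfl
  · simpa [altProdRev] using Γ.altProdRev_σ_comm hv.symm (k := 2) (by rw [h v hv]; rfl)

/-- The center of an Artin group is infinite cyclic when it is generated by a standard
generator. -/
theorem nonempty_center_mulEquiv_of_σ_mem {t : V} (ht : Γ.σ t ∈ Subgroup.center Γ.ArtinGroup)
    (h : ∀ z ∈ Subgroup.center Γ.ArtinGroup, ∃ n : ℤ, Γ.σ t ^ n = z) :
    Nonempty (Subgroup.center Γ.ArtinGroup ≃* Multiplicative (Fin 1 → ℤ)) := by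
  have hbij : Function.Bijective
      (zpowersHom (Subgroup.center Γ.ArtinGroup) ⟨Γ.σ t, ht⟩) := by
    refine ⟨(injective_iff_map_eq_one _).2 fun n hn => ?_, fun ⟨z, hz⟩ => ?_⟩
    · rw [zpowersHom_apply] at hn
      exact (Γ.σ_zpow_eq_one_iff t _).1 (congrArg Subtype.val hn)
    · obtain ⟨n, rfl⟩ := h z hz
      exact ⟨Multiplicative.ofAdd n, rfl⟩
  exact ⟨(MulEquiv.ofBijective _ hbij).symm.trans
    (AddEquiv.funUnique (Fin 1) ℤ).symm.toMultiplicative⟩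

theorem nonempty_center_mulEquiv_of_eq_one
    (h : ∀ z ∈ Subgroup.center Γ.ArtinGroup, z = 1) :
    Nonempty (Subgroup.center Γ.ArtinGroup ≃* Multiplicative (Fin 0 → ℤ)) := by
  have : Subsingleton (Subgroup.center Γ.ArtinGroup) :=
    ⟨fun x y => Subtype.ext ((h x x.2).trans (h y y.2).symm)⟩
  have : Subsingleton (Multiplicative (Fin 0 → ℤ)) := inferInstanceAs (Subsingleton (Fin 0 → ℤ))
  have := uniqueOfSubsingleton (1 : Subgroup.center Γ.ArtinGroup)
  have := uniqueOfSubsingleton (1 : Multiplicative (Fin 0 → ℤ))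
  exact ⟨MulEquiv.ofUnique⟩

theorem Irreducible.exists_m_ne_two (h : Γ.Irreducible) (t : V) (hV : ∃ v, v ≠ t) :
    ∃ v, v ≠ t ∧ Γ.m t v ≠ 2 := by
  by_contra! h2
  refine h ⟨{t}, {t}ᶜ, Set.singleton_nonempty t, hV, disjoint_compl_right,
    Set.union_compl_self _, ?_⟩
  rintro _ rfl v hv
  exact h2 v hv

end LabelledGraph

/-- Every Artin group whose defining labelled graph has exactly one
cone point satisfies the Center Conjecture. -/
theorem satisfiesCenterConjecture_of_single_conePoint {V : Type*} [Finite V]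
    (Γ : LabelledGraph V) (h : ∃ t : V, {v | Γ.IsConePoint v} = {t}) :
    Γ.SatisfiesCenterConjecture := by
  obtain ⟨t, ht⟩ := h
  rintro n P ⟨hne, hcov, hdisj, hlab, hirr⟩
  have hmem (v : V) : ∃ i, v ∈ P i := Set.mem_iUnion.1 (hcov ▸ Set.mem_univ v)
  have hcone (v : V) (hv : v ≠ t) : ∃ w, v ≠ w ∧ Γ.m v w = ⊤ := by
    have hv' : ¬ Γ.IsConePoint v := fun h => hv (ht.subset h)
    simp only [LabelledGraph.IsConePoint] at hv'
    push Not at hv'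
    obtain ⟨w, hw, hm⟩ := hv'
    exact ⟨w, hw.symm, hm⟩
  have hcenter {z : Γ.ArtinGroup} (hz : z ∈ Subgroup.center Γ.ArtinGroup) :
      ∃ n : ℤ, Γ.σ t ^ n = z :=
    LabelledGraph.exists_zpow_of_mem_center hcone hz
  have hsph (i : Fin n) (hi : (Γ.induce (P i)).Spherical) : P i = {t} := by
    refine (hne i).subset_singleton_iff.1 fun v hv => ?_
    by_contra hvt
    obtain ⟨w, hvw, hm⟩ := hcone v hvt
    obtain ⟨j, hj⟩ := hmem w
    obtain rfl : i = j := by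
      by_contra hij
      rw [hlab i j hij v hv w hj] at hm
      exact absurd hm (by decide)
    exact LabelledGraph.not_spherical_of_m_eq_top (Γ := Γ.induce (P i)) (u := ⟨v, hv⟩)
      (v := ⟨w, hj⟩) (fun e => hvw (congrArg Subtype.val e)) hm hi
  by_cases hex : ∃ i, (Γ.induce (P i)).Spherical
  · obtain ⟨i, hi⟩ := hex
    have hcard : Nat.card {i : Fin n // (Γ.induce (P i)).Spherical} = 1 := by
      refine Nat.card_eq_one_iff_exists.2 ⟨⟨i, hi⟩, fun ⟨j, hj⟩ => Subtype.ext ?_⟩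
      by_contra hji
      have := hdisj j i hji
      rw [hsph i hi, hsph j hj] at this
      simp at this
    rw [hcard]
    refine LabelledGraph.nonempty_center_mulEquiv_of_σ_mem (t := t)
      (LabelledGraph.σ_mem_center fun v hv => ?_) fun z hz => hcenter hz
    obtain ⟨j, hj⟩ := hmem v
    refine hlab i j ?_ t (hsph i hi ▸ rfl) v hj
    rintro rfl
    rw [hsph i hi] at hj
    exact hv hj
  · push Not at hex
    have hcard : Nat.card {i : Fin n // (Γ.induce (P i)).Spherical} = 0 := by
      have : IsEmpty {i : Fin n // (Γ.induce (P i)).Spherical} := ⟨fun i => hex i i.2⟩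
      exact Nat.card_of_isEmpty
    rw [hcard]
    obtain ⟨i, hti⟩ := hmem t
    have hV : ∃ v : P i, v ≠ ⟨t, hti⟩ := by
      by_contra! hu
      have : Unique (P i) := ⟨⟨⟨t, hti⟩⟩, hu⟩
      exact hex i LabelledGraph.spherical_of_unique
    obtain ⟨⟨v, hvi⟩, hvt, hm⟩ := (hirr i).exists_m_ne_two ⟨t, hti⟩ hV
    refine LabelledGraph.nonempty_center_mulEquiv_of_eq_one fun z hz => ?_
    obtain ⟨k, rfl⟩ := hcenter hz
    have hk : k = 0 := LabelledGraph.eq_zero_of_commute_σ_zpow (t := t) (v := v)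
      (fun e => hvt (Subtype.ext e.symm)) hm (Subgroup.mem_center_iff.1 hz _).symm
    rw [hk, zpow_zero]
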